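/- arXiv:2604.03530 — 4 statements merged into one kernel-verified Lean document; each statement's English description precedes it below -/
import Mathlib

section
/- For every integer n ≥ 2 and every real number q, the split reliability polynomials of complete graphs missing an edge satisfy S_n(q) = Σ_{a=1}^{n-1} binomial(n-2, a-1) · C_a(q) · C_{n-a}(q) · q^{a(n-a)-1}. -/
open SimpleGraph Finset

noncomputable section

/-- The finset of edges of a simple graph on a finite vertex type. -/
def edgeFin {V : Type} [Finite V] (G : SimpleGraph V) : Finset (Sym2 V) :=
  (Set.toFinite G.edgeSet).toFinset

open Classical in
/-- All-terminal reliability polynomial: `relPoly G q` is the probability that the graph stays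
connected when every edge fails independently with probability `q`. -/
def relPoly {V : Type} [Finite V] (G : SimpleGraph V) (q : ℝ) : ℝ :=
  ∑ A ∈ (edgeFin G).powerset,
    if (SimpleGraph.fromEdgeSet (A : Set (Sym2 V))).Connected then
      (1 - q) ^ A.card * q ^ ((edgeFin G).card - A.card) else 0

open Classical in
/-- Split reliability polynomial with terminals `u`, `v`: the sum is over edge subsets whose
spanning subgraph has exactly two components, one containing `u` and the other containing `v`. -/
def splitRel {V : Type} [Finite V] (H : SimpleGraph V) (u v : V) (q : ℝ) : ℝ :=
  ∑ A ∈ (edgeFin H).powerset,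
    if (¬ (SimpleGraph.fromEdgeSet (A : Set (Sym2 V))).Reachable u v ∧
        ∀ w, (SimpleGraph.fromEdgeSet (A : Set (Sym2 V))).Reachable u w ∨
             (SimpleGraph.fromEdgeSet (A : Set (Sym2 V))).Reachable v w) then
      (1 - q) ^ A.card * q ^ ((edgeFin H).card - A.card) else 0

/-- The virtual edge interaction `ŷ_H = Rel(H)/S(H) + 1`. -/
def yhat {V : Type} [Finite V] (H : SimpleGraph V) (u v : V) (q : ℝ) : ℝ :=
  relPoly H q / splitRel H u v q + 1

/-- `Hgraph n` is the complete graph on `Fin n` with the edge between `0` and `1` removed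
(for `n ≥ 2`; for `n < 2` no edge is removed). -/
def Hgraph (n : ℕ) : SimpleGraph (Fin n) :=
  (⊤ : SimpleGraph (Fin n)).deleteEdges
    {e | ∃ _h : 2 ≤ n, e = s(⟨0, by omega⟩, ⟨1, by omega⟩)}

/-- `Cfun n q = Rel(K_n; q)`. -/
def Cfun (n : ℕ) (q : ℝ) : ℝ := relPoly (⊤ : SimpleGraph (Fin n)) q

/-- `Rfun n q = Rel(H_n; q)` where `H_n = K_n` minus an edge. -/
def Rfun (n : ℕ) (q : ℝ) : ℝ := relPoly (Hgraph n) q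

/-- `Sfun n q = S(H_n; q)`, the split reliability of `K_n` minus the edge `uv`,
with terminals `u`, `v` the endpoints of the deleted edge. -/
def Sfun (n : ℕ) (q : ℝ) : ℝ :=
  if h : 2 ≤ n then splitRel (Hgraph n) ⟨0, by omega⟩ ⟨1, by omega⟩ q else 0

/-- `yfun n q = ŷ_{H_n}(q)`. -/
def yfun (n : ℕ) (q : ℝ) : ℝ := Rfun n q / Sfun n q + 1

/-- The edges of the complete graph on the vertex set `W`. -/
def innerEdges {V : Type} [DecidableEq V] (W : Finset V) : Finset (Sym2 V) :=
  W.sym2.filter fun e => ¬ e.IsDiag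

lemma mk_mem_innerEdges {V : Type} [DecidableEq V] {W : Finset V} {x y : V} :
    s(x, y) ∈ innerEdges W ↔ (x ∈ W ∧ y ∈ W) ∧ x ≠ y := by
  simp [innerEdges]

lemma card_innerEdges {V : Type} [DecidableEq V] (W : Finset V) :
    (innerEdges W).card = W.card.choose 2 := by
  rw [← Sym2.card_image_offDiag]
  congr 1
  ext e
  induction e with
  | h x y =>
    simp only [mk_mem_innerEdges, Finset.mem_image, Finset.mem_offDiag, Prod.exists]
    constructor
    · rintro ⟨⟨hx, hy⟩, hxy⟩
      exact ⟨x, y, ⟨hx, hy, hxy⟩, rfl⟩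
    · rintro ⟨a, b, ⟨ha, hb, hab⟩, h⟩
      rcases Sym2.eq_iff.1 h with ⟨rfl, rfl⟩ | ⟨rfl, rfl⟩
      · exact ⟨⟨ha, hb⟩, hab⟩
      · exact ⟨⟨hb, ha⟩, hab.symm⟩

lemma disjoint_innerEdges_compl {V : Type} [Fintype V] [DecidableEq V] (W : Finset V) :
    Disjoint (innerEdges W) (innerEdges Wᶜ) := by
  rw [Finset.disjoint_left]
  intro e
  induction e with
  | h x y =>
    simp only [mk_mem_innerEdges, Finset.mem_compl]
    tauto

lemma choose_two_add (a b : ℕ) :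
    (a + b).choose 2 = a.choose 2 + b.choose 2 + a * b := by
  induction b with
  | zero => simp
  | succ b ih =>
    rw [← add_assoc, Nat.choose_succ_succ' (a + b) 1, Nat.choose_succ_succ' b 1, ih]
    simp only [Nat.choose_one_right]
    ring

/-- `B` connects all vertices of `W` with one another. -/
def Spans {V : Type} (B : Finset (Sym2 V)) (W : Finset V) : Prop :=
  ∀ x ∈ W, ∀ y ∈ W, (fromEdgeSet (B : Set (Sym2 V))).Reachable x y

open Classical in
/-- The reliability polynomial of the complete graph on the vertex set `W`. -/
def relOn {V : Type} [DecidableEq V] (W : Finset V) (q : ℝ) : ℝ :=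
  ∑ B ∈ (innerEdges W).powerset with Spans B W,
    (1 - q) ^ B.card * q ^ ((innerEdges W).card - B.card)

lemma reachable_of_adj_imp {V : Type} {G G' : SimpleGraph V} {W : Finset V}
    (h : ∀ a b, a ∈ W → G.Adj a b → b ∈ W ∧ G'.Adj a b) {x y : V} (hx : x ∈ W)
    (hxy : G.Reachable x y) : y ∈ W ∧ G'.Reachable x y := by
  rw [reachable_iff_reflTransGen] at hxy
  induction hxy with
  | refl => exact ⟨hx, .rfl⟩
  | tail _ hbc ih =>
    obtain ⟨hb, hxb⟩ := ih
    obtain ⟨hc, hbc'⟩ := h _ _ hb hbc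
    exact ⟨hc, hxb.trans hbc'.reachable⟩

lemma edgeFin_top {V : Type} [Fintype V] [DecidableEq V] :
    edgeFin (⊤ : SimpleGraph V) = innerEdges Finset.univ := by
  ext e
  induction e with
  | h x y => simp [edgeFin, mk_mem_innerEdges]

lemma innerEdges_map {U V : Type} [DecidableEq U] [DecidableEq V] (f : U ↪ V) (W : Finset U) :
    innerEdges (W.map f) = (innerEdges W).map f.sym2Map := by
  ext e
  induction e with
  | h x y =>
    simp only [mk_mem_innerEdges, Finset.mem_map, Sym2.exists, Function.Embedding.sym2Map_apply,
      Sym2.map_mk]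
    constructor
    · rintro ⟨⟨⟨a, ha, rfl⟩, ⟨b, hb, rfl⟩⟩, hab⟩
      exact ⟨a, b, ⟨⟨ha, hb⟩, fun h => hab (h ▸ rfl)⟩, rfl⟩
    · rintro ⟨a, b, ⟨⟨ha, hb⟩, hab⟩, h⟩
      rcases Sym2.eq_iff.1 h with ⟨rfl, rfl⟩ | ⟨rfl, rfl⟩
      · exact ⟨⟨⟨a, ha, rfl⟩, b, hb, rfl⟩, f.injective.ne hab⟩
      · exact ⟨⟨⟨b, hb, rfl⟩, a, ha, rfl⟩, f.injective.ne hab.symm⟩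

lemma fromEdgeSet_map_adj {U V : Type} (f : U ↪ V) (B : Finset (Sym2 U)) (x y : U) :
    (fromEdgeSet (B.map f.sym2Map : Set (Sym2 V))).Adj (f x) (f y) ↔
      (fromEdgeSet (B : Set (Sym2 U))).Adj x y := by
  have h : s(f x, f y) = f.sym2Map s(x, y) := rfl
  rw [fromEdgeSet_adj, fromEdgeSet_adj, h, Finset.mem_coe, Finset.mem_map', Finset.mem_coe,
    f.injective.ne_iff]

lemma exists_of_fromEdgeSet_map_adj {U V : Type} (f : U ↪ V) (B : Finset (Sym2 U)) {x : U} {z : V}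
    (h : (fromEdgeSet (B.map f.sym2Map : Set (Sym2 V))).Adj (f x) z) : ∃ y, f y = z := by
  rw [fromEdgeSet_adj, Finset.mem_coe, Finset.mem_map] at h
  obtain ⟨⟨e, _, he⟩, _⟩ := h
  induction e with
  | h a b =>
    rcases Sym2.eq_iff.1 he with ⟨_, h⟩ | ⟨h, _⟩
    exacts [⟨b, h⟩, ⟨a, h⟩]

lemma reachable_map_iff {U V : Type} (f : U ↪ V) (B : Finset (Sym2 U)) (x y : U) :
    (fromEdgeSet (B.map f.sym2Map : Set (Sym2 V))).Reachable (f x) (f y) ↔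
      (fromEdgeSet (B : Set (Sym2 U))).Reachable x y := by
  constructor
  · suffices ∀ z, (fromEdgeSet (B.map f.sym2Map : Set (Sym2 V))).Reachable (f x) z →
        ∃ y, f y = z ∧ (fromEdgeSet (B : Set (Sym2 U))).Reachable x y by
      intro h
      obtain ⟨y', hy', hr⟩ := this _ h
      rwa [← f.injective hy']
    intro z hz
    rw [reachable_iff_reflTransGen] at hz
    induction hz with
    | refl => exact ⟨x, rfl, .rfl⟩
    | tail _ hbc ih =>
      obtain ⟨b, rfl, hxb⟩ := ih
      obtain ⟨c, rfl⟩ := exists_of_fromEdgeSet_map_adj f B hbc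
      exact ⟨c, rfl, hxb.trans ((fromEdgeSet_map_adj f B b c).1 hbc).reachable⟩
  · exact Reachable.map ⟨f, fun h => (fromEdgeSet_map_adj f B _ _).2 h⟩

lemma spans_map_iff {U V : Type} (f : U ↪ V) (B : Finset (Sym2 U)) (W : Finset U) :
    Spans (B.map f.sym2Map) (W.map f) ↔ Spans B W := by
  simp only [Spans, Finset.forall_mem_map, reachable_map_iff]

lemma relOn_map {U V : Type} [DecidableEq U] [DecidableEq V] (f : U ↪ V) (W : Finset U) (q : ℝ) :
    relOn (W.map f) q = relOn W q := by
  classical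
  symm
  refine Finset.sum_bij (fun B _ => B.map f.sym2Map) ?_ ?_ ?_ ?_
  · intro B hB
    rw [Finset.mem_filter, Finset.mem_powerset] at hB ⊢
    rw [innerEdges_map]
    exact ⟨Finset.map_subset_map.2 hB.1, (spans_map_iff f B W).2 hB.2⟩
  · intro B _ B' _ h
    exact Finset.map_injective _ h
  · intro B hB
    rw [Finset.mem_filter, Finset.mem_powerset, innerEdges_map, Finset.subset_map_iff] at hB
    obtain ⟨⟨B, hBs, rfl⟩, hB⟩ := hB
    exact ⟨B, Finset.mem_filter.2 ⟨Finset.mem_powerset.2 hBs, (spans_map_iff f B W).1 hB⟩, rfl⟩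
  · intro B _
    rw [innerEdges_map, Finset.card_map, Finset.card_map]

lemma relOn_univ (a : ℕ) (ha : 0 < a) (q : ℝ) :
    relOn (Finset.univ : Finset (Fin a)) q = Cfun a q := by
  classical
  have : Nonempty (Fin a) := ⟨⟨0, ha⟩⟩
  rw [relOn, Cfun, relPoly, edgeFin_top, Finset.sum_filter]
  refine Finset.sum_congr rfl fun B _ => ?_
  simp [Spans, connected_iff, Preconnected, this]

lemma relOn_eq_Cfun {V : Type} [DecidableEq V] (W : Finset V) (hW : W.Nonempty) (q : ℝ) :
    relOn W q = Cfun W.card q := by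
  let f : Fin W.card ↪ V := W.equivFin.symm.toEmbedding.trans (Function.Embedding.subtype _)
  have hf : Finset.univ.map f = W := by
    rw [← Finset.map_map, Finset.map_univ_equiv]
    ext x
    simp
  rw [← relOn_univ _ hW.card_pos, ← relOn_map f, hf]

/-- The edge set `A` has exactly two components, the one of `u`, which is `W`, and that of `v`. -/
def SplitsAs {V : Type} (A : Finset (Sym2 V)) (u v : V) (W : Finset V) : Prop :=
  (∀ w, w ∈ W ↔ (fromEdgeSet (A : Set (Sym2 V))).Reachable u w) ∧
    (∀ w, w ∉ W ↔ (fromEdgeSet (A : Set (Sym2 V))).Reachable v w)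

lemma SplitsAs.subset {V : Type} [Fintype V] [DecidableEq V] {A : Finset (Sym2 V)} {u v : V}
    {W : Finset V} (h : SplitsAs A u v W) (hA : A ⊆ innerEdges Finset.univ) :
    A ⊆ innerEdges W ∪ innerEdges Wᶜ := by
  intro e he
  induction e with
  | h x y =>
    have hne : x ≠ y := (mk_mem_innerEdges.1 (hA he)).2
    have hadj : (fromEdgeSet (A : Set (Sym2 V))).Adj x y := (fromEdgeSet_adj _).2 ⟨he, hne⟩
    have hxy : x ∈ W ↔ y ∈ W := by
      rw [h.1, h.1]
      exact ⟨fun h => h.trans hadj.reachable, fun h => h.trans hadj.symm.reachable⟩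
    simp only [Finset.mem_union, mk_mem_innerEdges, Finset.mem_compl]
    tauto

lemma spans_inter {V : Type} [Fintype V] [DecidableEq V] {A : Finset (Sym2 V)} {u : V}
    {W : Finset V} (hA : A ⊆ innerEdges W ∪ innerEdges Wᶜ)
    (h : ∀ w ∈ W, (fromEdgeSet (A : Set (Sym2 V))).Reachable u w) :
    Spans (A ∩ innerEdges W) W := by
  intro x hx y hy
  refine (reachable_of_adj_imp (fun a b ha hab => ?_) hx ((h x hx).symm.trans (h y hy))).2
  rw [fromEdgeSet_adj, Finset.mem_coe] at hab
  have hmem := hA hab.1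
  simp only [Finset.mem_union, mk_mem_innerEdges, Finset.mem_compl] at hmem
  simp only [fromEdgeSet_adj, Finset.mem_coe, Finset.mem_inter, mk_mem_innerEdges]
  tauto

lemma mem_iff_reachable_union {V : Type} [Fintype V] [DecidableEq V] {B C : Finset (Sym2 V)} {u : V}
    {W : Finset V} (hu : u ∈ W) (hB : B ⊆ innerEdges W) (hC : C ⊆ innerEdges Wᶜ)
    (h : Spans B W) (w : V) :
    w ∈ W ↔ (fromEdgeSet ((B ∪ C : Finset (Sym2 V)) : Set (Sym2 V))).Reachable u w := by
  constructor
  · intro hw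
    exact (h u hu w hw).mono (fromEdgeSet_mono (by simp))
  · intro hw
    refine (reachable_of_adj_imp (G' := ⊤) (fun a b ha hab => ?_) hu hw).1
    rw [fromEdgeSet_adj, Finset.mem_coe, Finset.mem_union] at hab
    refine ⟨?_, hab.2⟩
    rcases hab.1 with h | h
    · exact (mk_mem_innerEdges.1 (hB h)).1.2
    · exact absurd ha (Finset.mem_compl.1 (mk_mem_innerEdges.1 (hC h)).1.1)

lemma splitsAs_union {V : Type} [Fintype V] [DecidableEq V] {B C : Finset (Sym2 V)} {u v : V}
    {W : Finset V} (hu : u ∈ W) (hv : v ∉ W) (hB : B ⊆ innerEdges W) (hC : C ⊆ innerEdges Wᶜ)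
    (hBW : Spans B W) (hCW : Spans C Wᶜ) : SplitsAs (B ∪ C) u v W := by
  refine ⟨mem_iff_reachable_union hu hB hC hBW, fun w => ?_⟩
  rw [← Finset.mem_compl, Finset.union_comm]
  exact mem_iff_reachable_union (Finset.mem_compl.2 hv) hC (by rwa [compl_compl]) hCW w

open Classical in
lemma sum_splitsAs {V : Type} [Fintype V] [DecidableEq V] {u v : V} {W : Finset V} (hu : u ∈ W)
    (hv : v ∉ W) (q : ℝ) :
    (∑ A ∈ ((innerEdges Finset.univ).erase s(u, v)).powerset with SplitsAs A u v W,
      (1 - q) ^ A.card *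
        q ^ (((innerEdges (Finset.univ : Finset V)).erase s(u, v)).card - A.card)) =
      relOn W q * relOn Wᶜ q * q ^ (W.card * Wᶜ.card - 1) := by
  have huv : u ≠ v := fun h => hv (h ▸ hu)
  have hcard : ((innerEdges (Finset.univ : Finset V)).erase s(u, v)).card =
      (innerEdges W).card + (innerEdges Wᶜ).card + (W.card * Wᶜ.card - 1) := by
    rw [Finset.card_erase_of_mem (mk_mem_innerEdges.2 (by simpa using huv)), card_innerEdges,
      card_innerEdges, card_innerEdges, Finset.card_univ, ← Finset.card_add_card_compl W,
      choose_two_add]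
    have : 0 < W.card * Wᶜ.card :=
      Nat.mul_pos (Finset.card_pos.2 ⟨u, hu⟩) (Finset.card_pos.2 ⟨v, Finset.mem_compl.2 hv⟩)
    omega
  have hdisj := disjoint_innerEdges_compl W
  rw [hcard, relOn, relOn, Finset.sum_mul_sum, ← Finset.sum_product', Finset.sum_mul]
  symm
  refine Finset.sum_nbij' (fun p => p.1 ∪ p.2) (fun A => (A ∩ innerEdges W, A ∩ innerEdges Wᶜ))
    ?_ ?_ ?_ ?_ ?_
  · rintro ⟨B, C⟩ h
    simp only [Finset.mem_product, Finset.mem_filter, Finset.mem_powerset] at h ⊢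
    obtain ⟨⟨hB, hBW⟩, hC, hCW⟩ := h
    refine ⟨fun e he => ?_, splitsAs_union hu hv hB hC hBW hCW⟩
    have hmem := Finset.union_subset_union hB hC he
    induction e with
    | h x y =>
      simp only [Finset.mem_union, mk_mem_innerEdges, Finset.mem_compl] at hmem
      rw [Finset.mem_erase, mk_mem_innerEdges]
      refine ⟨fun h => ?_, by simp, by tauto⟩
      rcases Sym2.eq_iff.1 h with ⟨rfl, rfl⟩ | ⟨rfl, rfl⟩ <;> tauto
  · intro A h
    simp only [Finset.mem_product, Finset.mem_filter, Finset.mem_powerset] at h ⊢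
    have hA := h.2.subset (h.1.trans (Finset.erase_subset _ _))
    refine ⟨⟨Finset.inter_subset_right, spans_inter hA fun w => (h.2.1 w).1⟩,
      Finset.inter_subset_right, spans_inter (u := v) ?_ fun w hw => ?_⟩
    · rwa [compl_compl, Finset.union_comm]
    · exact (h.2.2 w).1 (Finset.mem_compl.1 hw)
  · rintro ⟨B, C⟩ h
    simp only [Finset.mem_product, Finset.mem_filter, Finset.mem_powerset] at h
    obtain ⟨⟨hB, -⟩, hC, -⟩ := h
    have h1 : C ∩ innerEdges W = ∅ :=
      Finset.disjoint_iff_inter_eq_empty.1 (hdisj.symm.mono_left hC)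
    have h2 : B ∩ innerEdges Wᶜ = ∅ :=
      Finset.disjoint_iff_inter_eq_empty.1 (hdisj.mono_left hB)
    simp [Finset.union_inter_distrib_right, h1, h2, Finset.inter_eq_left.2 hB,
      Finset.inter_eq_left.2 hC]
  · intro A h
    simp only [Finset.mem_filter, Finset.mem_powerset] at h
    simp only [← Finset.inter_union_distrib_left]
    exact Finset.inter_eq_left.2 (h.2.subset (h.1.trans (Finset.erase_subset _ _)))
  · rintro ⟨B, C⟩ h
    simp only [Finset.mem_product, Finset.mem_filter, Finset.mem_powerset] at h
    obtain ⟨⟨hB, -⟩, hC, -⟩ := h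
    have hBc := Finset.card_le_card hB
    have hCc := Finset.card_le_card hC
    simp only [Finset.card_union_of_disjoint (Finset.disjoint_of_subset_left hB
      (Finset.disjoint_of_subset_right hC hdisj))]
    rw [show (innerEdges W).card + (innerEdges Wᶜ).card + (W.card * Wᶜ.card - 1) -
        (B.card + C.card) = ((innerEdges W).card - B.card) + ((innerEdges Wᶜ).card - C.card) +
        (W.card * Wᶜ.card - 1) by omega]
    ring

open Classical in
lemma splitRel_eq_sum {V : Type} [Fintype V] [DecidableEq V] {H : SimpleGraph V} {u v : V}
    (hH : edgeFin H = (innerEdges Finset.univ).erase s(u, v)) (q : ℝ) :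
    splitRel H u v q = ∑ W : Finset V with u ∈ W ∧ v ∉ W,
      relOn W q * relOn Wᶜ q * q ^ (W.card * Wᶜ.card - 1) := by
  have hsplit : splitRel H u v q =
      ∑ A ∈ ((innerEdges Finset.univ).erase s(u, v)).powerset.filter fun A : Finset (Sym2 V) =>
        ¬ (fromEdgeSet (A : Set (Sym2 V))).Reachable u v ∧
          ∀ w, (fromEdgeSet (A : Set (Sym2 V))).Reachable u w ∨
            (fromEdgeSet (A : Set (Sym2 V))).Reachable v w,
        (1 - q) ^ A.card * q ^ (((innerEdges Finset.univ).erase s(u, v)).card - A.card) := by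
    rw [splitRel, hH, Finset.sum_filter]
    exact Finset.sum_congr rfl fun _ _ => by congr
  rw [hsplit, ← Finset.sum_fiberwise_of_maps_to
    (t := Finset.univ.filter fun W : Finset V => u ∈ W ∧ v ∉ W)
    (g := fun A : Finset (Sym2 V) => Finset.univ.filter fun w =>
      (fromEdgeSet (A : Set (Sym2 V))).Reachable u w)]
  · refine Finset.sum_congr rfl fun W hW => ?_
    obtain ⟨hu, hv⟩ := (Finset.mem_filter.1 hW).2
    rw [← sum_splitsAs hu hv, Finset.filter_filter]
    refine Finset.sum_congr (Finset.filter_congr fun A _ => ?_) fun _ _ => rfl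
    constructor
    · rintro ⟨⟨h1, h2⟩, rfl⟩
      refine ⟨fun w => by simp, fun w => ?_⟩
      simp only [Finset.mem_filter, Finset.mem_univ, true_and]
      exact ⟨(h2 w).resolve_left, fun h h' => h1 (h'.trans h.symm)⟩
    · rintro ⟨h1, h2⟩
      refine ⟨⟨fun h => hv ((h1 v).2 h), fun w => ?_⟩, ?_⟩
      · rw [← h1, ← h2]
        exact Classical.em _
      · ext w
        simp [h1]
  · intro A hA
    simp only [Finset.mem_filter, Finset.mem_univ, true_and] at hA ⊢
    exact ⟨.rfl, hA.2.1⟩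

lemma sum_separating {V : Type} [Fintype V] [DecidableEq V] {u v : V} (huv : u ≠ v) (F : ℕ → ℝ) :
    ∑ W : Finset V with u ∈ W ∧ v ∉ W, F W.card =
      ∑ a ∈ Finset.Icc 1 (Fintype.card V - 1),
        ((Fintype.card V - 2).choose (a - 1) : ℝ) * F a := by
  have hc : (Finset.univ \ {u, v} : Finset V).card = Fintype.card V - 2 := by
    rw [Finset.card_univ_sdiff, Finset.card_pair huv]
  have h2 : 2 ≤ Fintype.card V := by
    rw [← Finset.card_pair huv]
    exact Finset.card_le_univ _
  have : ∑ W : Finset V with u ∈ W ∧ v ∉ W, F W.card =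
      ∑ T ∈ (Finset.univ \ {u, v} : Finset V).powerset, F (T.card + 1) := by
    refine Finset.sum_nbij' (fun W => W.erase u) (fun T => insert u T) ?_ ?_ ?_ ?_ ?_
    · intro W hW
      simp only [Finset.mem_filter, Finset.mem_univ, true_and] at hW
      simp only [Finset.mem_powerset]
      intro x hx
      simp only [Finset.mem_erase] at hx
      simp only [Finset.mem_sdiff, Finset.mem_univ, true_and, Finset.mem_insert,
        Finset.mem_singleton, not_or]
      exact ⟨hx.1, fun h => hW.2 (h ▸ hx.2)⟩
    · intro T hT
      have hvT : v ∉ T := fun h => by simpa using Finset.mem_powerset.1 hT h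
      simp [hvT, huv.symm]
    · intro W hW
      exact Finset.insert_erase (Finset.mem_filter.1 hW).2.1
    · intro T hT
      exact Finset.erase_insert fun h => by simpa using Finset.mem_powerset.1 hT h
    · intro W hW
      rw [Finset.card_erase_add_one (Finset.mem_filter.1 hW).2.1]
  rw [this, Finset.sum_powerset_apply_card (fun k => F (k + 1)), hc]
  refine Finset.sum_nbij' (· + 1) (· - 1) ?_ ?_ ?_ ?_ ?_
  · intro k hk
    rw [Finset.mem_range] at hk
    rw [Finset.mem_Icc]
    omega
  · intro a ha
    rw [Finset.mem_Icc] at ha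
    rw [Finset.mem_range]
    omega
  · intro k _
    simp
  · intro a ha
    exact Nat.sub_add_cancel (Finset.mem_Icc.1 ha).1
  · intro k _
    simp

/-- Recurrence for the split reliability polynomials:
`S_n(q) = ∑_{a=1}^{n-1} C(n-2, a-1) C_a(q) C_{n-a}(q) q^{a(n-a)-1}`. -/
theorem split_rec (n : ℕ) (hn : 2 ≤ n) (q : ℝ) :
    Sfun n q = ∑ a ∈ Finset.Icc 1 (n - 1),
      ((n - 2).choose (a - 1) : ℝ) * Cfun a q * Cfun (n - a) q * q ^ (a * (n - a) - 1) := by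
  classical
  have hne : (⟨0, by omega⟩ : Fin n) ≠ ⟨1, by omega⟩ := by simp
  have hH : edgeFin (Hgraph n) =
      (innerEdges Finset.univ).erase s((⟨0, by omega⟩ : Fin n), ⟨1, by omega⟩) := by
    ext e
    induction e with
    | h x y =>
      simp [edgeFin, Hgraph, mk_mem_innerEdges, hn]
      tauto
  have key := sum_separating hne
    fun a => Cfun a q * Cfun (n - a) q * q ^ (a * (n - a) - 1)
  rw [Fintype.card_fin] at key
  simp only [mul_assoc] at key ⊢
  rw [Sfun, dif_pos hn, splitRel_eq_sum hH, ← key]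
  refine Finset.sum_congr (by ext; simp) fun W hW => ?_
  obtain ⟨hu, hv⟩ := (Finset.mem_filter.1 hW).2
  rw [relOn_eq_Cfun W ⟨_, hu⟩, relOn_eq_Cfun Wᶜ ⟨_, Finset.mem_compl.2 hv⟩, Finset.card_compl,
    Fintype.card_fin, mul_assoc]

end
end

section
/- For every integer n ≥ 3 and every real number q, the reliability polynomials of complete graphs missing an edge satisfy R_n(q) = 1 - Σ_{a=1}^{n-1} binomial(n-2, a-1) · C_a(q) · q^{a(n-a)-1} - Σ_{a=3}^{n-1} binomial(n-2, a-2) · R_a(q) · q^{a(n-a)}. -/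
open SimpleGraph Finset

noncomputable section

/-- The probability that exactly the edges in `A` survive, among the edges in `E`. -/
def edgeWeight {α : Type} (q : ℝ) (E A : Finset α) : ℝ :=
  (1 - q) ^ A.card * q ^ (E.card - A.card)

theorem sum_edgeWeight {α : Type} (q : ℝ) (E : Finset α) :
    ∑ A ∈ E.powerset, edgeWeight q E A = 1 := by
  unfold edgeWeight
  rw [Finset.sum_pow_mul_eq_add_pow]
  simp

theorem edgeWeight_empty {α : Type} (q : ℝ) (E : Finset α) :
    edgeWeight q E ∅ = q ^ E.card := by
  simp [edgeWeight]

theorem edgeWeight_union {α : Type} [DecidableEq α] (q : ℝ) {E₁ E₂ A₁ A₂ : Finset α}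
    (h : Disjoint E₁ E₂) (h₁ : A₁ ⊆ E₁) (h₂ : A₂ ⊆ E₂) :
    edgeWeight q (E₁ ∪ E₂) (A₁ ∪ A₂) = edgeWeight q E₁ A₁ * edgeWeight q E₂ A₂ := by
  unfold edgeWeight
  rw [Finset.card_union_of_disjoint h, Finset.card_union_of_disjoint (h.mono h₁ h₂)]
  have e₁ := Finset.card_le_card h₁
  have e₂ := Finset.card_le_card h₂
  have : E₁.card + E₂.card - (A₁.card + A₂.card)
      = (E₁.card - A₁.card) + (E₂.card - A₂.card) := by omega
  rw [this, pow_add, pow_add]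
  ring

theorem sum_powerset_union {α : Type} [DecidableEq α] {E₁ E₂ : Finset α}
    (h : Disjoint E₁ E₂) (F : Finset α → ℝ) :
    ∑ A ∈ (E₁ ∪ E₂).powerset, F A
      = ∑ A₁ ∈ E₁.powerset, ∑ A₂ ∈ E₂.powerset, F (A₁ ∪ A₂) := by
  rw [← Finset.sum_product']
  refine Finset.sum_nbij' (fun A => (A ∩ E₁, A ∩ E₂)) (fun p => p.1 ∪ p.2) ?_ ?_ ?_ ?_ ?_
  · intro A _
    simp
  · rintro ⟨A₁, A₂⟩ hA
    simp only [Finset.mem_product, Finset.mem_powerset] at hA ⊢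
    exact Finset.union_subset_union hA.1 hA.2
  · intro A hA
    rw [Finset.mem_powerset] at hA
    simp only [← Finset.inter_union_distrib_left]
    exact Finset.inter_eq_left.2 hA
  · rintro ⟨A₁, A₂⟩ hA
    simp only [Finset.mem_product, Finset.mem_powerset] at hA
    rw [Finset.disjoint_left] at h
    ext x
    · have := @h x
      have := @hA.1 x
      have := @hA.2 x
      simp only [Finset.mem_inter, Finset.mem_union]
      tauto
    · have := @h x
      have := @hA.1 x
      have := @hA.2 x
      simp only [Finset.mem_inter, Finset.mem_union]
      tauto
  · intro A hA
    rw [Finset.mem_powerset] at hA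
    rw [← Finset.inter_union_distrib_left, Finset.inter_eq_left.2 hA]

theorem mem_edgeFin {V : Type} [Finite V] {G : SimpleGraph V} {e : Sym2 V} :
    e ∈ edgeFin G ↔ e ∈ G.edgeSet := by
  simp [edgeFin]

/-- Vertices reached from `u` along steps that preserve `P` satisfy `P`. -/
theorem reachable_induction {V : Type} {G : SimpleGraph V} {u w : V} {P : V → Prop}
    (h : G.Reachable u w) (hu : P u) (step : ∀ x y, P x → G.Adj x y → P y) : P w := by
  rw [SimpleGraph.reachable_iff_reflTransGen] at h
  induction h with
  | refl => exact hu
  | tail _ hxy ih => exact step _ _ ih hxy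

section Cut

variable {V : Type} [Fintype V] [DecidableEq V]

open Classical in
/-- The edges of `G` with both ends in `S`. -/
def edgesInside (G : SimpleGraph V) (S : Finset V) : Finset (Sym2 V) :=
  (edgeFin G).filter fun e => ∀ x ∈ e, x ∈ S

open Classical in
/-- The edges of `G` between `S` and its complement. -/
def edgesCut (G : SimpleGraph V) (S : Finset V) : Finset (Sym2 V) :=
  (edgeFin G).filter fun e => (∃ x ∈ e, x ∈ S) ∧ ∃ x ∈ e, x ∉ S

open Classical in
/-- The probability that the edges of `G` surviving inside `S` connect `u` to all of `S`. -/
def relInside (G : SimpleGraph V) (S : Finset V) (u : V) (q : ℝ) : ℝ :=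
  ∑ B ∈ (edgesInside G S).powerset,
    if ∀ w ∈ S, (SimpleGraph.fromEdgeSet (B : Set (Sym2 V))).Reachable u w then
      edgeWeight q (edgesInside G S) B else 0

theorem edgesInside_union_cut_union_inside_compl (G : SimpleGraph V) (S : Finset V) :
    edgesInside G S ∪ (edgesCut G S ∪ edgesInside G Sᶜ) = edgeFin G := by
  ext e
  induction e with | _ x y
  simp only [edgesInside, edgesCut, Finset.mem_union, Finset.mem_filter, Sym2.mem_iff,
    Finset.mem_compl, forall_eq_or_imp, exists_eq_or_imp, forall_eq, exists_eq_left]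
  tauto

theorem disjoint_edgesCut_edgesInside_compl (G : SimpleGraph V) (S : Finset V) :
    Disjoint (edgesCut G S) (edgesInside G Sᶜ) := by
  rw [Finset.disjoint_left]
  intro e
  induction e with | _ x y
  simp only [edgesInside, edgesCut, Finset.mem_filter, Sym2.mem_iff,
    Finset.mem_compl, forall_eq_or_imp, exists_eq_or_imp, forall_eq, exists_eq_left]
  tauto

theorem disjoint_edgesInside (G : SimpleGraph V) (S : Finset V) :
    Disjoint (edgesInside G S) (edgesCut G S ∪ edgesInside G Sᶜ) := by
  rw [Finset.disjoint_left]
  intro e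
  induction e with | _ x y
  simp only [edgesInside, edgesCut, Finset.mem_filter, Finset.mem_union, Sym2.mem_iff,
    Finset.mem_compl, forall_eq_or_imp, exists_eq_or_imp, forall_eq, exists_eq_left]
  tauto

theorem reachable_iff_mem_iff {G : SimpleGraph V} {S : Finset V} {u : V} (hu : u ∈ S)
    {B C D : Finset (Sym2 V)} (hB : B ⊆ edgesInside G S) (hC : C ⊆ edgesCut G S)
    (hD : D ⊆ edgesInside G Sᶜ) :
    (∀ w, (SimpleGraph.fromEdgeSet ((B ∪ (C ∪ D) : Finset (Sym2 V)) : Set (Sym2 V))).Reachable u w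
        ↔ w ∈ S) ↔
      C = ∅ ∧ ∀ w ∈ S, (SimpleGraph.fromEdgeSet (B : Set (Sym2 V))).Reachable u w := by
  have hB' : ∀ x y, s(x, y) ∈ B → x ∈ S ∧ y ∈ S := by
    intro x y h
    have := (Finset.mem_filter.1 (hB h)).2
    simpa using this
  have hD' : ∀ x y, s(x, y) ∈ D → x ∉ S ∧ y ∉ S := by
    intro x y h
    have := (Finset.mem_filter.1 (hD h)).2
    simpa using this
  have hC' : ∀ x y, s(x, y) ∈ C → (x ∈ S ∧ y ∉ S) ∨ (x ∉ S ∧ y ∈ S) := by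
    intro x y h
    have := (Finset.mem_filter.1 (hC h)).2
    simp only [Sym2.mem_iff, exists_eq_or_imp, exists_eq_left] at this
    tauto
  constructor
  · intro h
    have closed : ∀ x y, x ∈ S → s(x, y) ∈ C → y ∈ S := by
      intro x y hx hxy
      by_cases hne : x = y
      · exact hne ▸ hx
      · refine (h y).1 (((h x).2 hx).trans (SimpleGraph.Adj.reachable ?_))
        rw [SimpleGraph.fromEdgeSet_adj]
        exact ⟨by simp [hxy], hne⟩
    refine ⟨?_, ?_⟩
    · rw [Finset.eq_empty_iff_forall_notMem]
      intro e
      induction e with | _ x y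
      intro hxy
      rcases hC' x y hxy with ⟨hx, hy⟩ | ⟨hx, hy⟩
      · exact hy (closed x y hx hxy)
      · exact hx (closed y x hy (Sym2.eq_swap ▸ hxy))
    · intro w hw
      have key := reachable_induction
        (P := fun z => z ∈ S ∧ (SimpleGraph.fromEdgeSet (B : Set (Sym2 V))).Reachable u z)
        ((h w).2 hw) ⟨hu, SimpleGraph.Reachable.refl u⟩ ?_
      · exact key.2
      · rintro x y ⟨hx, hr⟩ hxy
        rw [SimpleGraph.fromEdgeSet_adj] at hxy
        obtain ⟨hmem, hne⟩ := hxy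
        simp only [Finset.coe_union, Set.mem_union, Finset.mem_coe] at hmem
        rcases hmem with hm | hm | hm
        · refine ⟨(hB' x y hm).2, hr.trans (SimpleGraph.Adj.reachable ?_)⟩
          rw [SimpleGraph.fromEdgeSet_adj]
          exact ⟨hm, hne⟩
        · have := closed x y hx hm
          have := hC' x y hm
          tauto
        · exact absurd hx (hD' x y hm).1
  · rintro ⟨rfl, h⟩ w
    constructor
    · intro hr
      refine reachable_induction (P := fun z => z ∈ S) hr hu ?_
      intro x y hx hxy
      rw [SimpleGraph.fromEdgeSet_adj] at hxy
      have hmem := hxy.1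
      simp only [Finset.coe_union, Set.mem_union, Finset.mem_coe, Finset.notMem_empty,
        false_or] at hmem
      rcases hmem with hm | hm
      · exact (hB' x y hm).2
      · exact absurd hx (hD' x y hm).1
    · intro hw
      refine (h w hw).mono (SimpleGraph.fromEdgeSet_mono ?_)
      intro e he
      simp only [Finset.coe_union, Set.mem_union]
      exact Or.inl he

open Classical in
theorem sum_component_eq (G : SimpleGraph V) {S : Finset V} {u : V} (hu : u ∈ S) (q : ℝ) :
    (∑ A ∈ (edgeFin G).powerset,
      if ∀ w, (SimpleGraph.fromEdgeSet (A : Set (Sym2 V))).Reachable u w ↔ w ∈ S then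
        edgeWeight q (edgeFin G) A else 0)
      = relInside G S u q * q ^ (edgesCut G S).card := by
  rw [← edgesInside_union_cut_union_inside_compl G S, sum_powerset_union (disjoint_edgesInside G S),
    relInside, Finset.sum_mul]
  refine Finset.sum_congr rfl fun B hB => ?_
  rw [sum_powerset_union (disjoint_edgesCut_edgesInside_compl G S)]
  rw [Finset.mem_powerset] at hB
  have hterm : ∀ C ∈ (edgesCut G S).powerset, ∀ D ∈ (edgesInside G Sᶜ).powerset,
      (if ∀ w, (SimpleGraph.fromEdgeSet
          ((B ∪ (C ∪ D) : Finset (Sym2 V)) : Set (Sym2 V))).Reachable u w ↔ w ∈ S then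
        edgeWeight q (edgesInside G S ∪ (edgesCut G S ∪ edgesInside G Sᶜ)) (B ∪ (C ∪ D)) else 0)
      = if C = ∅ then (if ∀ w ∈ S, (SimpleGraph.fromEdgeSet (B : Set (Sym2 V))).Reachable u w then
          edgeWeight q (edgesInside G S) B else 0) * edgeWeight q (edgesCut G S) ∅
          * edgeWeight q (edgesInside G Sᶜ) D else 0 := by
    intro C hC D hD
    rw [Finset.mem_powerset] at hC hD
    rw [edgeWeight_union q (disjoint_edgesInside G S) hB (Finset.union_subset_union hC hD),
      edgeWeight_union q (disjoint_edgesCut_edgesInside_compl G S) hC hD]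
    simp only [reachable_iff_mem_iff hu hB hC hD]
    by_cases hCe : C = ∅
    · subst hCe
      simp [mul_assoc]
    · simp [hCe]
  rw [Finset.sum_congr rfl fun C hC => Finset.sum_congr rfl (hterm C hC)]
  rw [Finset.sum_eq_single ∅]
  · simp only [if_true]
    rw [← Finset.mul_sum, sum_edgeWeight, edgeWeight_empty, mul_one]
  · intro C _ hC
    simp [hC]
  · simp

/-- Conditioning on the vertex set of the component of `u`. -/
theorem sum_relInside_mul_pow_cut (G : SimpleGraph V) (u : V) (q : ℝ) :
    (∑ S : Finset V, if u ∈ S then relInside G S u q * q ^ (edgesCut G S).card else 0) = 1 := by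
  classical
  rw [← sum_edgeWeight q (edgeFin G)]
  have hS : ∀ S : Finset V, (if u ∈ S then relInside G S u q * q ^ (edgesCut G S).card else 0)
      = ∑ A ∈ (edgeFin G).powerset,
        if ∀ w, (SimpleGraph.fromEdgeSet (A : Set (Sym2 V))).Reachable u w ↔ w ∈ S then
          edgeWeight q (edgeFin G) A else 0 := by
    intro S
    split_ifs with hu
    · exact (sum_component_eq G hu q).symm
    · refine (Finset.sum_eq_zero fun A _ => if_neg fun h => hu ?_).symm
      exact (h u).1 (SimpleGraph.Reachable.refl u)
  rw [Finset.sum_congr rfl fun S _ => hS S, Finset.sum_comm]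
  refine Finset.sum_congr rfl fun A _ => ?_
  rw [Finset.sum_eq_single
    (Finset.univ.filter fun w => (SimpleGraph.fromEdgeSet (A : Set (Sym2 V))).Reachable u w)]
  · simp
  · intro S _ hne
    refine if_neg fun h => hne ?_
    ext w
    simp [h w]
  · simp

/-- A copy of `H` induced by `G` on `S` has the reliability of `H`. -/
theorem relPoly_eq_relInside {W : Type} [Finite W] {H : SimpleGraph W} {G : SimpleGraph V}
    (f : W ↪ V) {S : Finset V} (hS : ∀ v, v ∈ S ↔ ∃ w, f w = v)
    (hadj : ∀ x y, G.Adj (f x) (f y) ↔ H.Adj x y) (u : W) (q : ℝ) :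
    relPoly H q = relInside G S (f u) q := by
  classical
  have hE : edgesInside G S = (edgeFin H).map f.sym2Map := by
    ext e
    induction e with | _ x y
    simp only [edgesInside, Finset.mem_filter, mem_edgeFin, Finset.mem_map,
      SimpleGraph.mem_edgeSet, Sym2.mem_iff, forall_eq_or_imp, forall_eq, hS]
    constructor
    · rintro ⟨hxy, ⟨a, rfl⟩, b, rfl⟩
      exact ⟨s(a, b), (hadj a b).1 hxy, rfl⟩
    · rintro ⟨e, he, hxy⟩
      induction e with | _ a b
      have hG := (hadj a b).2 he
      simp only [Function.Embedding.sym2Map_apply, Sym2.map_mk, Sym2.eq_iff] at hxy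
      rcases hxy with ⟨rfl, rfl⟩ | ⟨rfl, rfl⟩
      · exact ⟨hG, ⟨a, rfl⟩, b, rfl⟩
      · exact ⟨hG.symm, ⟨b, rfl⟩, a, rfl⟩
  have hmem : ∀ (A : Finset (Sym2 W)) x y, s(f x, f y) ∈ A.map f.sym2Map ↔ s(x, y) ∈ A := by
    intro A x y
    rw [← Finset.mem_map' f.sym2Map]
    rfl
  have hconn : ∀ A : Finset (Sym2 W), (SimpleGraph.fromEdgeSet (A : Set (Sym2 W))).Connected ↔
      ∀ v ∈ S, (SimpleGraph.fromEdgeSet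
        ((A.map f.sym2Map : Finset (Sym2 V)) : Set (Sym2 V))).Reachable (f u) v := by
    intro A
    constructor
    · intro h v hv
      obtain ⟨w, rfl⟩ := (hS v).1 hv
      refine reachable_induction (P := fun z => (SimpleGraph.fromEdgeSet
        ((A.map f.sym2Map : Finset (Sym2 V)) : Set (Sym2 V))).Reachable (f u) (f z))
        (h.preconnected u w) (SimpleGraph.Reachable.refl _) ?_
      intro x y hx hxy
      refine hx.trans (SimpleGraph.Adj.reachable ?_)
      rw [SimpleGraph.fromEdgeSet_adj] at hxy ⊢
      exact ⟨(hmem A x y).2 hxy.1, f.injective.ne hxy.2⟩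
    · intro h
      have hr : ∀ w, (SimpleGraph.fromEdgeSet (A : Set (Sym2 W))).Reachable u w := by
        intro w
        obtain ⟨z, hz, hr⟩ := reachable_induction (P := fun v => ∃ z, f z = v ∧
          (SimpleGraph.fromEdgeSet (A : Set (Sym2 W))).Reachable u z)
          (h (f w) ((hS _).2 ⟨w, rfl⟩)) ⟨u, rfl, SimpleGraph.Reachable.refl _⟩ (by
            rintro _ y ⟨z, rfl, hz⟩ hzy
            rw [SimpleGraph.fromEdgeSet_adj] at hzy
            have hy : y ∈ S := by
              obtain ⟨e, _, he⟩ := Finset.mem_map.1 (Finset.mem_coe.1 hzy.1)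
              have hy : y ∈ f.sym2Map e := he ▸ Sym2.mem_mk_right _ _
              obtain ⟨b, _, rfl⟩ := Sym2.mem_map.1 hy
              exact (hS _).2 ⟨b, rfl⟩
            obtain ⟨b, rfl⟩ := (hS y).1 hy
            refine ⟨b, rfl, hz.trans (SimpleGraph.Adj.reachable ?_)⟩
            rw [SimpleGraph.fromEdgeSet_adj]
            exact ⟨(hmem A z b).1 hzy.1, fun hzb => hzy.2 (congrArg f hzb)⟩)
        rwa [← f.injective hz]
      have : Nonempty W := ⟨u⟩
      exact ⟨fun a b => (hr a).symm.trans (hr b)⟩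
  rw [relPoly, relInside, hE]
  refine Finset.sum_nbij (fun A => A.map f.sym2Map) ?_ ?_ ?_ ?_
  · intro A hA
    rw [Finset.mem_powerset] at hA ⊢
    exact Finset.map_subset_map.2 hA
  · intro A _ B _ hAB
    exact Finset.map_injective _ hAB
  · intro B hB
    rw [Finset.mem_coe, Finset.mem_powerset] at hB
    obtain ⟨A, hA, rfl⟩ := Finset.subset_map_iff.1 hB
    exact ⟨A, Finset.mem_coe.2 (Finset.mem_powerset.2 hA), rfl⟩
  · intro A _
    simp only [hconn A, edgeWeight, Finset.card_map]

open Classical in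
theorem card_edgesCut (G : SimpleGraph V) (S : Finset V) :
    (edgesCut G S).card = ((S ×ˢ Sᶜ).filter fun p => G.Adj p.1 p.2).card := by
  symm
  refine Finset.card_nbij (fun p => s(p.1, p.2)) ?_ ?_ ?_
  · rintro ⟨x, y⟩ h
    simp only [Finset.mem_coe, Finset.mem_filter, Finset.mem_product, Finset.mem_compl] at h
    simp only [edgesCut, Finset.mem_coe, Finset.mem_filter, mem_edgeFin, SimpleGraph.mem_edgeSet]
    exact ⟨h.2, ⟨x, Sym2.mem_mk_left _ _, h.1.1⟩, y, Sym2.mem_mk_right _ _, h.1.2⟩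
  · rintro ⟨x, y⟩ h ⟨x', y'⟩ h' he
    simp only [Finset.mem_coe, Finset.mem_filter, Finset.mem_product, Finset.mem_compl] at h h'
    simp only [Sym2.eq_iff] at he
    rcases he with ⟨rfl, rfl⟩ | ⟨rfl, rfl⟩
    · rfl
    · exact absurd h.1.1 h'.1.2
  · intro e he
    induction e with | _ x y
    simp only [edgesCut, Finset.mem_coe, Finset.mem_filter, mem_edgeFin, SimpleGraph.mem_edgeSet,
      Sym2.mem_iff, exists_eq_or_imp, exists_eq_left] at he
    obtain ⟨hadj, h⟩ := he
    by_cases hx : x ∈ S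
    · exact ⟨(x, y), by simpa [hx, hadj] using h, rfl⟩
    · exact ⟨(y, x), by simpa [hx, hadj.symm] using h, Sym2.eq_swap⟩

end Cut

theorem Hgraph_adj {n : ℕ} {x y : Fin n} :
    (Hgraph n).Adj x y ↔
      x ≠ y ∧ ¬(x.val = 0 ∧ y.val = 1) ∧ ¬(x.val = 1 ∧ y.val = 0) := by
  simp only [Hgraph, SimpleGraph.deleteEdges_adj, SimpleGraph.top_adj, Set.mem_ofPred_eq,
    Sym2.eq_iff, Fin.ext_iff, not_exists]
  have := x.isLt
  have := y.isLt
  constructor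
  · rintro ⟨h, h'⟩
    refine ⟨h, fun hc => h' (by omega) (Or.inl hc), fun hc => h' (by omega) (Or.inr hc)⟩
  · rintro ⟨h, h₁, h₂⟩
    exact ⟨h, fun _ hc => hc.elim h₁ h₂⟩

theorem Rfun_two (q : ℝ) : Rfun 2 q = 0 := by
  have hE : edgeFin (Hgraph 2) = ∅ := by
    rw [Finset.eq_empty_iff_forall_notMem]
    intro e
    induction e with | _ x y
    rw [mem_edgeFin, SimpleGraph.mem_edgeSet, Hgraph_adj]
    omega
  rw [Rfun, relPoly, hE, Finset.powerset_empty, Finset.sum_singleton]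
  refine if_neg fun h => ?_
  have := reachable_induction (P := fun z : Fin 2 => z = 0) (h.preconnected 0 1) rfl (by simp)
  simp at this

theorem relInside_Hgraph_of_notMem {n : ℕ} (hn : 2 ≤ n) {S : Finset (Fin n)}
    (h0 : (⟨0, by omega⟩ : Fin n) ∈ S) (h1 : (⟨1, by omega⟩ : Fin n) ∉ S) (q : ℝ) :
    relInside (Hgraph n) S ⟨0, by omega⟩ q = Cfun S.card q := by
  have hS : ∀ v, v ∈ S ↔ ∃ w, (S.orderEmbOfFin rfl).toEmbedding w = v := fun v => by
    rw [← Finset.mem_coe, ← Finset.range_orderEmbOfFin S rfl]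
    rfl
  obtain ⟨u, hu⟩ := (hS _).1 h0
  rw [← hu]
  refine (relPoly_eq_relInside _ hS (fun x y => ?_) u q).symm
  have h1' : ∀ z, ((S.orderEmbOfFin rfl).toEmbedding z).val ≠ 1 := fun z hz =>
    h1 ((hS _).2 ⟨z, Fin.ext hz⟩)
  rw [Hgraph_adj, SimpleGraph.top_adj, (S.orderEmbOfFin rfl).toEmbedding.injective.ne_iff]
  have := h1' x
  have := h1' y
  tauto

theorem relInside_Hgraph_of_mem {n : ℕ} (hn : 2 ≤ n) {S : Finset (Fin n)}
    (h0 : (⟨0, by omega⟩ : Fin n) ∈ S) (h1 : (⟨1, by omega⟩ : Fin n) ∈ S) (q : ℝ) :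
    relInside (Hgraph n) S ⟨0, by omega⟩ q = Rfun S.card q := by
  set f := S.orderEmbOfFin rfl
  have hS : ∀ v, v ∈ S ↔ ∃ w, f.toEmbedding w = v := fun v => by
    rw [← Finset.mem_coe, ← Finset.range_orderEmbOfFin S rfl]
    rfl
  obtain ⟨u, hu⟩ := (hS _).1 h0
  obtain ⟨v, hv⟩ := (hS _).1 h1
  have hu' : (f u).val = 0 := congrArg Fin.val hu
  have hv' : (f v).val = 1 := congrArg Fin.val hv
  have hlt : ∀ {x y}, (f x).val < (f y).val ↔ x.val < y.val := f.lt_iff_lt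
  have hinj : ∀ {x y}, (f x).val = (f y).val ↔ x.val = y.val := fun {x y} => by
    rw [← Fin.ext_iff, ← Fin.ext_iff, f.injective.eq_iff]
  have huv : u.val < v.val := hlt.1 (by omega)
  have hu0 : u.val = 0 := by
    by_contra h
    have := (@hlt ⟨0, by omega⟩ u).2 (by simp; omega)
    omega
  have hv1 : v.val = 1 := by
    by_contra h
    have h₁ := (@hlt ⟨1, by omega⟩ v).2 (by simp; omega)
    have h₂ := (@hlt u ⟨1, by omega⟩).2 (by simp; omega)
    omega
  rw [← hu]
  refine (relPoly_eq_relInside f.toEmbedding hS (fun x y => ?_) u q).symm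
  have e0 : ∀ z, (f.toEmbedding z).val = 0 ↔ z.val = 0 := fun z => by
    have h : (f z).val = (f u).val ↔ z.val = u.val := hinj
    rwa [hu', hu0] at h
  have e1 : ∀ z, (f.toEmbedding z).val = 1 ↔ z.val = 1 := fun z => by
    have h : (f z).val = (f v).val ↔ z.val = v.val := hinj
    rwa [hv', hv1] at h
  rw [Hgraph_adj, Hgraph_adj, f.toEmbedding.injective.ne_iff, e0, e0, e1, e1]

theorem card_edgesCut_Hgraph_of_mem {n : ℕ} (hn : 2 ≤ n) {S : Finset (Fin n)}
    (h0 : (⟨0, by omega⟩ : Fin n) ∈ S) (h1 : (⟨1, by omega⟩ : Fin n) ∈ S) :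
    (edgesCut (Hgraph n) S).card = S.card * (n - S.card) := by
  classical
  rw [card_edgesCut, Finset.filter_true_of_mem, Finset.card_product, Finset.card_compl,
    Fintype.card_fin]
  rintro ⟨x, y⟩ h
  simp only [Finset.mem_product, Finset.mem_compl] at h
  rw [Hgraph_adj]
  refine ⟨fun (hxy : x = y) => h.2 (hxy ▸ h.1), fun hy => h.2 ?_, fun hy => h.2 ?_⟩
  · exact (Fin.ext hy.2 : y = ⟨1, by omega⟩) ▸ h1
  · exact (Fin.ext hy.2 : y = ⟨0, by omega⟩) ▸ h0

theorem card_edgesCut_Hgraph_of_notMem {n : ℕ} (hn : 2 ≤ n) {S : Finset (Fin n)}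
    (h0 : (⟨0, by omega⟩ : Fin n) ∈ S) (h1 : (⟨1, by omega⟩ : Fin n) ∉ S) :
    (edgesCut (Hgraph n) S).card = S.card * (n - S.card) - 1 := by
  classical
  have hfilter : ((S ×ˢ Sᶜ).filter fun p => (Hgraph n).Adj p.1 p.2)
      = (S ×ˢ Sᶜ).erase (⟨0, by omega⟩, ⟨1, by omega⟩) := by
    ext ⟨x, y⟩
    simp only [Finset.mem_filter, Finset.mem_erase, Finset.mem_product, Finset.mem_compl,
      Hgraph_adj, ne_eq, Prod.mk.injEq]
    have hxy : x ∈ S → y ∉ S → x ≠ y := fun hx hy hxy => hy (hxy ▸ hx)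
    have hx1 : x ∈ S → x.val ≠ 1 := fun hx h => h1 ((Fin.ext h : x = ⟨1, by omega⟩) ▸ hx)
    have hx0 : x = ⟨0, by omega⟩ ↔ x.val = 0 := Fin.ext_iff
    have hy1 : y = ⟨1, by omega⟩ ↔ y.val = 1 := Fin.ext_iff
    rw [hx0, hy1]
    tauto
  rw [card_edgesCut, hfilter, Finset.card_erase_of_mem (by simp [h0, h1]), Finset.card_product,
    Finset.card_compl, Fintype.card_fin]

/-- Sums over vertex sets containing `u`, split according to whether they contain `v`. -/
theorem sum_finset_mem_split {V : Type} [Fintype V] [DecidableEq V] {u v : V} (huv : u ≠ v)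
    (F : Finset V → ℝ) (f g : ℕ → ℝ)
    (hf : ∀ S, u ∈ S → v ∉ S → F S = f S.card) (hg : ∀ S, u ∈ S → v ∈ S → F S = g S.card) :
    (∑ S : Finset V, if u ∈ S then F S else 0)
      = (∑ k ∈ Finset.range (Fintype.card V - 2 + 1),
          ((Fintype.card V - 2).choose k : ℝ) * f (k + 1))
        + ∑ k ∈ Finset.range (Fintype.card V - 2 + 1),
          ((Fintype.card V - 2).choose k : ℝ) * g (k + 2) := by
  set T : Finset V := Finset.univ \ {u, v} with hT
  have hTu : u ∉ T := by simp [hT]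
  have hTv : v ∉ T := by simp [hT]
  have huniv : (Finset.univ : Finset (Finset V)) = (insert u (insert v T)).powerset := by
    ext S
    simp only [Finset.mem_univ, Finset.mem_powerset, true_iff]
    intro x _
    simp only [hT, Finset.mem_insert, Finset.mem_sdiff, Finset.mem_univ, Finset.mem_singleton]
    tauto
  have hcard : T.card = Fintype.card V - 2 := by
    rw [hT, Finset.card_sdiff_of_subset (Finset.subset_univ _), Finset.card_pair huv,
      Finset.card_univ]
  have huvT : u ∉ insert v T := by simp [huv, hTu]
  rw [huniv, Finset.sum_powerset_insert huvT]
  rw [Finset.sum_eq_zero (s := (insert v T).powerset) (fun S hS => if_neg fun h =>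
    huvT (Finset.mem_powerset.1 hS h)), zero_add, Finset.sum_powerset_insert hTv, ← hcard]
  congr 1
  · have := Finset.sum_powerset_apply_card (fun k => f (k + 1)) (x := T)
    simp only [nsmul_eq_mul] at this
    rw [← this]
    refine Finset.sum_congr rfl fun S hS => ?_
    have hSu : u ∉ S := fun h => hTu (Finset.mem_powerset.1 hS h)
    have hSv : v ∉ S := fun h => hTv (Finset.mem_powerset.1 hS h)
    rw [if_pos (Finset.mem_insert_self _ _), hf _ (Finset.mem_insert_self _ _)
      (by simp [huv.symm, hSv]), Finset.card_insert_of_notMem hSu]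
  · have := Finset.sum_powerset_apply_card (fun k => g (k + 2)) (x := T)
    simp only [nsmul_eq_mul] at this
    rw [← this]
    refine Finset.sum_congr rfl fun S hS => ?_
    have hSu : u ∉ S := fun h => hTu (Finset.mem_powerset.1 hS h)
    have hSv : v ∉ S := fun h => hTv (Finset.mem_powerset.1 hS h)
    rw [if_pos (Finset.mem_insert_self _ _), hg _ (Finset.mem_insert_self _ _) (by simp),
      Finset.card_insert_of_notMem (by simp [huv, hSu]), Finset.card_insert_of_notMem hSv]

/-- Recurrence for the reliability polynomials of complete graphs missing an edge:
`R_n(q) = 1 - ∑_{a=1}^{n-1} C(n-2, a-1) C_a(q) q^{a(n-a)-1}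
        - ∑_{a=3}^{n-1} C(n-2, a-2) R_a(q) q^{a(n-a)}`. -/
theorem rminus_rec (n : ℕ) (hn : 3 ≤ n) (q : ℝ) :
    Rfun n q = 1 - (∑ a ∈ Finset.Icc 1 (n - 1),
        ((n - 2).choose (a - 1) : ℝ) * Cfun a q * q ^ (a * (n - a) - 1))
      - ∑ a ∈ Finset.Icc 3 (n - 1),
        ((n - 2).choose (a - 2) : ℝ) * Rfun a q * q ^ (a * (n - a)) := by
  have hn2 : 2 ≤ n := by omega
  have hcond := sum_relInside_mul_pow_cut (Hgraph n) ⟨0, by omega⟩ q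
  rw [sum_finset_mem_split (v := ⟨1, by omega⟩) (Fin.ne_of_val_ne zero_ne_one) _
    (fun a => Cfun a q * q ^ (a * (n - a) - 1)) (fun a => Rfun a q * q ^ (a * (n - a)))
    (fun S h0 h1 => by
      rw [relInside_Hgraph_of_notMem hn2 h0 h1, card_edgesCut_Hgraph_of_notMem hn2 h0 h1])
    (fun S h0 h1 => by
      rw [relInside_Hgraph_of_mem hn2 h0 h1, card_edgesCut_Hgraph_of_mem hn2 h0 h1]),
    Fintype.card_fin] at hcond
  obtain ⟨m, rfl⟩ : ∃ m, n = m + 3 := ⟨n - 3, by omega⟩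
  have hC : ∑ a ∈ Finset.Icc 1 (m + 3 - 1),
        ((m + 3 - 2).choose (a - 1) : ℝ) * Cfun a q * q ^ (a * (m + 3 - a) - 1)
      = ∑ k ∈ Finset.range (m + 3 - 2 + 1), ((m + 3 - 2).choose k : ℝ) *
        (Cfun (k + 1) q * q ^ ((k + 1) * (m + 3 - (k + 1)) - 1)) := by
    rw [← Finset.Ico_add_one_right_eq_Icc, Finset.sum_Ico_eq_sum_range]
    refine Finset.sum_congr (by congr 1) fun k _ => ?_
    rw [Nat.add_sub_cancel_left, Nat.add_comm 1 k, mul_assoc]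
  have hR : ∑ a ∈ Finset.Icc 3 (m + 3 - 1),
        ((m + 3 - 2).choose (a - 2) : ℝ) * Rfun a q * q ^ (a * (m + 3 - a))
      = ∑ k ∈ Finset.range m, ((m + 3 - 2).choose (k + 1) : ℝ) *
        (Rfun (k + 1 + 2) q * q ^ ((k + 1 + 2) * (m + 3 - (k + 1 + 2)))) := by
    rw [← Finset.Ico_add_one_right_eq_Icc, Finset.sum_Ico_eq_sum_range]
    refine Finset.sum_congr (by congr 1) fun k _ => ?_
    rw [show 3 + k - 2 = k + 1 by omega, show 3 + k = k + 1 + 2 by omega, mul_assoc]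
  rw [← hC, show m + 3 - 2 + 1 = m + 1 + 1 by omega, Finset.sum_range_succ', zero_add, Rfun_two,
    Finset.sum_range_succ, ← hR, show m + 3 - 2 = m + 1 by omega] at hcond
  simp only [Nat.choose_self, Nat.sub_self, mul_zero, zero_mul, pow_zero, Nat.cast_one, one_mul,
    mul_one, add_zero] at hcond
  rw [show m + 3 - 2 = m + 1 by omega]
  change _ + (_ + Rfun (m + 3) q) = _ at hcond
  linarith

end
end

section
/- Let G be a finite connected simple graph with m edges, and for each i let F_i denote the number of i-element edge subsets B ⊆ E(G) such that the graph obtained from G by deleting the edges in B is connected; set F(G,z) = Σ_i F_i z^i. Let H be a finite connected simple graph with two distinguished nonadjacent terminal vertices u and v, and let G[H] be the edge-substitution graph obtained from G by replacing each edge ab of G by a fresh copy of H, identifying u with a and v with b. Then for every real number q, Rel(G[H];q) = (Rel(H;q))^m · F(G, S(H;q)/Rel(H;q)) whenever Rel(H;q) ≠ 0; equivalently, as polynomial identity, Rel(G[H];q) = Σ_i F_i · S(H;q)^i · Rel(H;q)^{m-i}. -/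
open SimpleGraph Finset

noncomputable section

/-- Vertex type of the edge-substitution graph `G[H]`: the original vertices of `G` together
with, for each edge of `G`, a fresh copy of the non-terminal vertices of `H`. -/
abbrev SubVert {V W : Type} (G : SimpleGraph V) (u v : W) : Type :=
  V ⊕ (G.edgeSet × {w : W // w ≠ u ∧ w ≠ v})

open Classical in
/-- Embedding of the copy of `H` corresponding to the edge `e` of `G` into the vertex set of
`G[H]`: the terminal `u` goes to one endpoint of `e`, the terminal `v` to the other endpoint,
and the remaining vertices go to the fresh copy indexed by `e`. -/
def embv {V W : Type} (G : SimpleGraph V) (u v : W) (e : G.edgeSet) (w : W) :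
    SubVert G u v :=
  if h1 : w = u then Sum.inl (Quot.out e.1).1
  else if h2 : w = v then Sum.inl (Quot.out e.1).2
  else Sum.inr (e, ⟨w, h1, h2⟩)

/-- The edge-substitution graph `G[H]`: every edge `ab` of `G` is replaced by a fresh copy of
`H`, identifying the terminal `u` with `a` and the terminal `v` with `b`. -/
def subGraph {V W : Type} (G : SimpleGraph V) (H : SimpleGraph W) (u v : W) :
    SimpleGraph (SubVert G u v) :=
  SimpleGraph.fromRel (fun x y =>
    ∃ (e : G.edgeSet) (a b : W), H.Adj a b ∧ x = embv G u v e a ∧ y = embv G u v e b)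

open Classical in
/-- `Fpoly G z = ∑_i F_i z^i`, where `F_i` is the number of `i`-element edge subsets of `G`
whose deletion leaves a connected graph. -/
def Fpoly {V : Type} [Finite V] (G : SimpleGraph V) (z : ℝ) : ℝ :=
  ∑ B ∈ (edgeFin G).powerset,
    if (G.deleteEdges (B : Set (Sym2 V))).Connected then z ^ B.card else 0

/-- `u` and `v` lie in different components of `G`, and there is no further component. -/
def IsSplit {W : Type} (G : SimpleGraph W) (u v : W) : Prop :=
  ¬ G.Reachable u v ∧ ∀ w, G.Reachable u w ∨ G.Reachable v w

theorem IsSplit.not_connected {W : Type} {G : SimpleGraph W} {u v : W} (h : IsSplit G u v) :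
    ¬ G.Connected :=
  fun hc => h.1 (hc.preconnected u v)

/-- A predicate that is stable under adjacency is stable under reachability. -/
theorem SimpleGraph.Reachable.induction_adj {X : Type*} {G : SimpleGraph X} {P : X → Prop}
    (hP : ∀ x y, G.Adj x y → P x → P y) {x y : X} (h : G.Reachable x y) (hx : P x) : P y := by
  obtain ⟨p⟩ := h
  induction p with
  | nil => exact hx
  | cons hadj _ ih => exact ih (hP _ _ hadj hx)

section Embedding

variable {V W : Type} (G : SimpleGraph V) {u v : W}

theorem embv_left (e : G.edgeSet) : embv G u v e u = Sum.inl (Quot.out e.1).1 := by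
  simp [embv]

theorem embv_right (huv : u ≠ v) (e : G.edgeSet) :
    embv G u v e v = Sum.inl (Quot.out e.1).2 := by
  simp [embv, huv.symm]

theorem embv_inner (e : G.edgeSet) (w : {w : W // w ≠ u ∧ w ≠ v}) :
    embv G u v e w = Sum.inr (e, w) := by
  simp [embv, w.2.1, w.2.2]

theorem embv_eq_inr_iff {e : G.edgeSet} {a : W}
    {p : G.edgeSet × {w : W // w ≠ u ∧ w ≠ v}} :
    embv G u v e a = Sum.inr p ↔ e = p.1 ∧ a = p.2 := by
  constructor
  · intro h
    unfold embv at h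
    split_ifs at h with h1 h2
    cases Sum.inr_injective h
    exact ⟨rfl, rfl⟩
  · rintro ⟨rfl, rfl⟩
    exact embv_inner G _ _

theorem mk_out (e : Sym2 V) : s((Quot.out e).1, (Quot.out e).2) = e :=
  Quot.out_eq e

theorem adj_out (e : G.edgeSet) : G.Adj (Quot.out e.1).1 (Quot.out e.1).2 := by
  rw [← SimpleGraph.mem_edgeSet, mk_out]
  exact e.2

theorem embv_injective (huv : u ≠ v) (e : G.edgeSet) :
    Function.Injective (embv G u v e) := by
  have hne := (adj_out G e).ne
  have hleft {b : W} (h : embv G u v e u = embv G u v e b) : u = b := by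
    by_contra hu
    by_cases hv : b = v
    · rw [hv, embv_left, embv_right G huv] at h
      exact hne (Sum.inl_injective h)
    · rw [embv_left, embv_inner G e ⟨b, Ne.symm hu, hv⟩] at h
      exact Sum.inl_ne_inr h
  intro a b h
  by_cases hau : a = u
  · subst hau
    exact hleft h
  by_cases hbu : b = u
  · subst hbu
    exact (hleft h.symm).symm
  by_cases hav : a = v
  · by_contra hab
    rw [hav, embv_right G huv, embv_inner G e ⟨b, hbu, fun hb => hab (hav.trans hb.symm)⟩] at h
    exact Sum.inl_ne_inr h
  · rw [embv_inner G e ⟨a, hau, hav⟩] at h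
    exact ((embv_eq_inr_iff G).1 h.symm).2.symm

theorem map_embv_inj (huv : u ≠ v) {e e' : G.edgeSet} {f f' : Sym2 W}
    (hf : ¬ f.IsDiag) (hne : f ≠ s(u, v))
    (h : Sym2.map (embv G u v e) f = Sym2.map (embv G u v e') f') : e = e' ∧ f = f' := by
  have hw : ∃ w ∈ f, w ≠ u ∧ w ≠ v := by
    induction f with
    | _ a b =>
      by_contra! hcon
      have ha := hcon a (by simp)
      have hb := hcon b (by simp)
      rw [Sym2.mk_isDiag_iff] at hf
      rw [Ne, Sym2.eq_iff] at hne
      clear h hcon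
      grind
  obtain ⟨w, hwf, hw⟩ := hw
  have hmem : embv G u v e w ∈ Sym2.map (embv G u v e') f' :=
    h ▸ Sym2.mem_map.2 ⟨w, hwf, rfl⟩
  obtain ⟨w', -, hw'⟩ := Sym2.mem_map.1 hmem
  rw [embv_inner G e ⟨w, hw⟩, embv_eq_inr_iff] at hw'
  obtain rfl : e' = e := hw'.1
  exact ⟨rfl, Sym2.map.injective (embv_injective G huv e') h⟩

theorem map_embv_inj_of_mem {H : SimpleGraph W} (huv : u ≠ v) (hadj : ¬ H.Adj u v)
    {e e' : G.edgeSet} {f f' : Sym2 W} (hf : f ∈ H.edgeSet)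
    (h : Sym2.map (embv G u v e) f = Sym2.map (embv G u v e') f') : e = e' ∧ f = f' :=
  map_embv_inj G huv (H.not_isDiag_of_mem_edgeSet hf) (by rintro rfl; exact hadj hf) h

/-- Connectedness of a graph glued from graphs `T e`, one for each edge `e` of `G`. -/
theorem connected_glue_iff (huv : u ≠ v) [Nonempty V] (T : G.edgeSet → SimpleGraph W)
    (K : SimpleGraph (SubVert G u v))
    (hK : ∀ x y, K.Adj x y ↔
      ∃ e a b, (T e).Adj a b ∧ x = embv G u v e a ∧ y = embv G u v e b) :
    K.Connected ↔ (∀ e, (T e).Connected ∨ IsSplit (T e) u v) ∧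
      (G.deleteEdges {e | ∃ h : e ∈ G.edgeSet, IsSplit (T ⟨e, h⟩) u v}).Connected := by
  set G' := G.deleteEdges {e | ∃ h : e ∈ G.edgeSet, IsSplit (T ⟨e, h⟩) u v} with hG'
  let φ (e : G.edgeSet) : T e →g K :=
    ⟨embv G u v e, fun {a b} h => (hK _ _).2 ⟨e, a, b, h, rfl, rfl⟩⟩
  have hφ (e : G.edgeSet) {a b : W} (h : (T e).Reachable a b) :
      K.Reachable (embv G u v e a) (embv G u v e b) := h.map (φ e)
  constructor
  · intro hc
    have hreach (e : G.edgeSet) (w : W) : (T e).Reachable u w ∨ (T e).Reachable v w := by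
      by_contra! hcon
      have hstep : ∀ x y, K.Adj x y → (∃ w', (T e).Reachable w w' ∧ x = embv G u v e w') →
          ∃ w', (T e).Reachable w w' ∧ y = embv G u v e w' := by
        rintro x y hxy ⟨w', hw', rfl⟩
        have hu : w' ≠ u := by rintro rfl; exact hcon.1 hw'.symm
        have hv : w' ≠ v := by rintro rfl; exact hcon.2 hw'.symm
        obtain ⟨e', a, b, hab, h1, rfl⟩ := (hK _ _).1 hxy
        rw [embv_inner G e ⟨w', hu, hv⟩] at h1
        obtain ⟨rfl, rfl⟩ := (embv_eq_inr_iff G).1 h1.symm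
        exact ⟨b, hw'.trans hab.reachable, rfl⟩
      obtain ⟨w', hw', h⟩ := (hc.preconnected (embv G u v e w) (embv G u v e u)).induction_adj
        hstep ⟨w, .refl _, rfl⟩
      obtain rfl := embv_injective G huv e h
      exact hcon.1 hw'.symm
    refine ⟨fun e => ?_, ?_⟩
    · by_cases h : (T e).Reachable u v
      · have hu (w : W) : (T e).Reachable u w := (hreach e w).elim id h.trans
        exact .inl (SimpleGraph.connected_iff _ |>.2
          ⟨fun a b => (hu a).symm.trans (hu b), ⟨u⟩⟩)
      · exact .inr ⟨h, hreach e⟩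
    · have hadj (e : G.edgeSet) (h : (T e).Reachable u v) :
          G'.Reachable (Quot.out e.1).1 (Quot.out e.1).2 := by
        refine SimpleGraph.Adj.reachable ?_
        rw [hG', SimpleGraph.deleteEdges_adj]
        refine ⟨adj_out G e, ?_⟩
        rw [mk_out]
        rintro ⟨_, hs⟩
        exact hs.1 h
      refine (SimpleGraph.connected_iff _).2 ⟨fun a b => ?_, ‹_›⟩
      let Q (e : G.edgeSet) (w : W) : Prop :=
        ((T e).Reachable u w ∧ G'.Reachable a (Quot.out e.1).1) ∨
          ((T e).Reachable v w ∧ G'.Reachable a (Quot.out e.1).2)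
      let P (x : SubVert G u v) : Prop := Sum.elim (G'.Reachable a) (fun p => Q p.1 p.2) x
      have hPQ (e : G.edgeSet) (w : W) : P (embv G u v e w) ↔ Q e w := by
        by_cases hu : w = u
        · subst hu
          rw [embv_left]
          refine ⟨fun h => .inl ⟨.refl _, h⟩, ?_⟩
          rintro (h | h)
          · exact h.2
          · exact h.2.trans (hadj e h.1.symm).symm
        by_cases hv : w = v
        · subst hv
          rw [embv_right G huv]
          refine ⟨fun h => .inr ⟨.refl _, h⟩, ?_⟩
          rintro (h | h)
          · exact h.2.trans (hadj e h.1)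
          · exact h.2
        rw [embv_inner G e ⟨w, hu, hv⟩]
        rfl
      have hstep : ∀ x y, K.Adj x y → P x → P y := by
        intro x y hxy hx
        obtain ⟨e, c, d, hcd, rfl, rfl⟩ := (hK _ _).1 hxy
        rw [hPQ] at hx ⊢
        exact hx.imp (fun h => ⟨h.1.trans hcd.reachable, h.2⟩)
          (fun h => ⟨h.1.trans hcd.reachable, h.2⟩)
      exact (hc.preconnected (Sum.inl a) (Sum.inl b)).induction_adj hstep
        (SimpleGraph.Reachable.refl a)
  · rintro ⟨hT, hc⟩
    have hV (a b : V) : K.Reachable (Sum.inl a) (Sum.inl b) := by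
      refine (hc.preconnected a b).induction_adj (P := fun b => K.Reachable (Sum.inl a) (Sum.inl b))
        (fun x y hxy hx => hx.trans ?_) (.refl _)
      rw [hG', SimpleGraph.deleteEdges_adj] at hxy
      obtain ⟨hxy, hns⟩ := hxy
      have hcon : (T ⟨s(x, y), hxy⟩).Connected :=
        (hT _).resolve_right fun hs => hns ⟨hxy, hs⟩
      have h := hφ _ (hcon.preconnected u v)
      rw [embv_left, embv_right G huv] at h
      have hout := mk_out s(x, y)
      rw [Sym2.eq_iff] at hout
      rcases hout with ⟨h1, h2⟩ | ⟨h1, h2⟩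
      · rwa [h1, h2] at h
      · rw [h1, h2] at h
        exact h.symm
    have hall (x : SubVert G u v) : ∃ a, K.Reachable (Sum.inl a) x := by
      rcases x with a | ⟨e, w⟩
      · exact ⟨a, .refl _⟩
      · rw [← embv_inner G e w]
        have : (T e).Reachable u w ∨ (T e).Reachable v w :=
          (hT e).elim (fun h => .inl (h.preconnected _ _)) (fun h => h.2 _)
        rcases this with h | h
        · exact ⟨_, embv_left G e ▸ hφ e h⟩
        · exact ⟨_, embv_right G huv e ▸ hφ e h⟩
    refine (SimpleGraph.connected_iff _).2 ⟨fun x y => ?_, inferInstance⟩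
    obtain ⟨a, ha⟩ := hall x
    obtain ⟨b, hb⟩ := hall y
    exact ha.symm.trans ((hV a b).trans hb)

end Embedding

section Gluing

variable {V W : Type} [Finite V] (G : SimpleGraph V) {u v : W}

instance : Fintype G.edgeSet := Fintype.ofFinite _

open Classical in
/-- The edges of `G[H]` obtained by choosing a set of edges in every copy of `H`. -/
def glueEdges (u v : W) (S : G.edgeSet → Finset (Sym2 W)) : Finset (Sym2 (SubVert G u v)) :=
  univ.biUnion fun e => (S e).image (Sym2.map (embv G u v e))

variable {G}

theorem mem_glueEdges {S : G.edgeSet → Finset (Sym2 W)} {x : Sym2 (SubVert G u v)} :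
    x ∈ glueEdges G u v S ↔ ∃ e, ∃ f ∈ S e, Sym2.map (embv G u v e) f = x := by
  simp [glueEdges]

open Classical in
/-- Only the set of split copies can contribute to the sum over the deleted edges of `G`. -/
theorem sum_powerset_ite_connected (T : G.edgeSet → SimpleGraph W) :
    (∑ B ∈ (edgeFin G).powerset, if (G.deleteEdges (B : Set (Sym2 V))).Connected then
        ∏ e : G.edgeSet, (if (if e.1 ∈ B then IsSplit (T e) u v else (T e).Connected)
          then (1 : ℝ) else 0) else 0) =
      if (∀ e, (T e).Connected ∨ IsSplit (T e) u v) ∧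
        (G.deleteEdges {e | ∃ h : e ∈ G.edgeSet, IsSplit (T ⟨e, h⟩) u v}).Connected
      then 1 else 0 := by
  set B₀ := (edgeFin G).filter fun e => ∃ h : e ∈ G.edgeSet, IsSplit (T ⟨e, h⟩) u v with hB₀
  have hcoe : (B₀ : Set (Sym2 V)) = {e | ∃ h : e ∈ G.edgeSet, IsSplit (T ⟨e, h⟩) u v} := by
    ext e
    simp only [hB₀, coe_filter, Set.mem_ofPred_eq, mem_edgeFin]
    exact ⟨fun h => h.2, fun h => ⟨h.1, h⟩⟩
  have hmem (e : G.edgeSet) : e.1 ∈ B₀ ↔ IsSplit (T e) u v := by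
    rw [← mem_coe, hcoe]
    exact ⟨fun h => h.2, fun h => ⟨e.2, h⟩⟩
  have hprod (B : Finset (Sym2 V)) :
      (∏ e : G.edgeSet, (if (if e.1 ∈ B then IsSplit (T e) u v else (T e).Connected)
          then (1 : ℝ) else 0)) =
        if ∀ e : G.edgeSet, (if e.1 ∈ B then IsSplit (T e) u v else (T e).Connected)
          then 1 else 0 := by
    simp only [prod_ite_zero, prod_const_one, mem_univ, true_implies]
  simp only [hprod]
  rw [sum_eq_single B₀]
  · rw [hcoe, ← ite_and]
    refine if_congr ?_ rfl rfl
    rw [and_comm]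
    refine and_congr_left fun _ => forall_congr' fun e => ?_
    simp only [hmem]
    by_cases h : IsSplit (T e) u v <;> simp [h]
  · intro B hB hne
    rw [← ite_and, if_neg]
    rintro ⟨-, hall⟩
    apply hne
    ext e
    by_cases he : e ∈ G.edgeSet
    · have h := hall ⟨e, he⟩
      rw [hmem ⟨e, he⟩]
      split_ifs at h with heB
      · exact iff_of_true heB h
      · exact iff_of_false heB fun hs => hs.not_connected h
    · refine iff_of_false (fun h => he (mem_edgeFin.1 (mem_powerset.1 hB h))) fun h => he ?_
      exact mem_edgeFin.1 (mem_filter.1 h).1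
  · exact fun h => absurd (mem_powerset.2 (filter_subset _ _)) h

theorem fromEdgeSet_glueEdges_adj (huv : u ≠ v) {S : G.edgeSet → Finset (Sym2 W)}
    (x y : SubVert G u v) :
    (SimpleGraph.fromEdgeSet (glueEdges G u v S : Set (Sym2 (SubVert G u v)))).Adj x y ↔
      ∃ e a b, (SimpleGraph.fromEdgeSet (S e : Set (Sym2 W))).Adj a b ∧
        x = embv G u v e a ∧ y = embv G u v e b := by
  simp only [SimpleGraph.fromEdgeSet_adj, mem_coe, mem_glueEdges]
  constructor
  · rintro ⟨⟨e, f, hf, h⟩, hne⟩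
    induction f with
    | _ a b =>
      rw [Sym2.map_mk, Sym2.eq_iff] at h
      rcases h with ⟨rfl, rfl⟩ | ⟨rfl, rfl⟩
      · exact ⟨e, a, b, ⟨hf, fun h => hne (h ▸ rfl)⟩, rfl, rfl⟩
      · exact ⟨e, b, a, ⟨Sym2.eq_swap ▸ hf, fun h => hne (h ▸ rfl)⟩, rfl, rfl⟩
  · rintro ⟨e, a, b, ⟨hf, hne⟩, rfl, rfl⟩
    exact ⟨⟨e, s(a, b), hf, rfl⟩, (embv_injective G huv e).ne hne⟩

variable {H : SimpleGraph W}

theorem map_embv_mem_glueEdges (huv : u ≠ v) (hadj : ¬ H.Adj u v)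
    {S : G.edgeSet → Finset (Sym2 W)} {e : G.edgeSet} {f : Sym2 W} (hf : f ∈ H.edgeSet) :
    Sym2.map (embv G u v e) f ∈ glueEdges G u v S ↔ f ∈ S e := by
  rw [mem_glueEdges]
  constructor
  · rintro ⟨e', f', hf', h⟩
    obtain ⟨rfl, rfl⟩ := map_embv_inj_of_mem G huv hadj hf h.symm
    exact hf'
  · exact fun h => ⟨e, f, h, rfl⟩

variable [Finite W]

theorem card_glueEdges (huv : u ≠ v) (hadj : ¬ H.Adj u v)
    {S : G.edgeSet → Finset (Sym2 W)} (hS : ∀ e, S e ⊆ edgeFin H) :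
    (glueEdges G u v S).card = ∑ e, (S e).card := by
  classical
  rw [glueEdges, card_biUnion]
  · exact sum_congr rfl fun e _ =>
      card_image_of_injective _ (Sym2.map.injective (embv_injective G huv e))
  · intro e _ e' _ hne
    rw [Function.onFun, Finset.disjoint_left]
    simp only [mem_image]
    rintro _ ⟨f, hf, rfl⟩ ⟨f', -, h⟩
    exact hne (map_embv_inj_of_mem G huv hadj (mem_edgeFin.1 (hS e hf)) h.symm).1

theorem edgeFin_subGraph (huv : u ≠ v) :
    edgeFin (subGraph G H u v) = glueEdges G u v fun _ => edgeFin H := by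
  ext x
  rw [mem_edgeFin, mem_glueEdges]
  induction x with
  | _ x y =>
    rw [SimpleGraph.mem_edgeSet, subGraph, SimpleGraph.fromRel_adj]
    constructor
    · rintro ⟨-, ⟨e, a, b, hab, rfl, rfl⟩ | ⟨e, a, b, hab, rfl, rfl⟩⟩
      · exact ⟨e, s(a, b), mem_edgeFin.2 hab, rfl⟩
      · exact ⟨e, s(b, a), mem_edgeFin.2 hab.symm, rfl⟩
    · rintro ⟨e, f, hf, h⟩
      induction f with
      | _ a b =>
        have hab : H.Adj a b := mem_edgeFin.1 hf
        rw [Sym2.map_mk, Sym2.eq_iff] at h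
        rcases h with ⟨rfl, rfl⟩ | ⟨rfl, rfl⟩
        · exact ⟨(embv_injective G huv e).ne hab.ne, .inl ⟨e, a, b, hab, rfl, rfl⟩⟩
        · exact ⟨(embv_injective G huv e).ne hab.ne', .inr ⟨e, a, b, hab, rfl, rfl⟩⟩

open Classical in
/-- Edge subsets of `G[H]` correspond to families of edge subsets of the copies of `H`. -/
theorem sum_powerset_edgeFin_subGraph {M : Type*} [AddCommMonoid M] (huv : u ≠ v)
    (hadj : ¬ H.Adj u v) (F : Finset (Sym2 (SubVert G u v)) → M) :
    ∑ A ∈ (edgeFin (subGraph G H u v)).powerset, F A =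
      ∑ S ∈ Fintype.piFinset (fun _ : G.edgeSet => (edgeFin H).powerset),
        F (glueEdges G u v S) := by
  symm
  refine sum_bij' (fun S _ => glueEdges G u v S)
    (fun A _ e => (edgeFin H).filter fun f => Sym2.map (embv G u v e) f ∈ A) ?_ ?_ ?_ ?_ ?_
  · intro S hS
    simp only [Fintype.mem_piFinset, mem_powerset] at hS
    rw [mem_powerset, edgeFin_subGraph huv]
    intro x hx
    obtain ⟨e, f, hf, rfl⟩ := mem_glueEdges.1 hx
    exact mem_glueEdges.2 ⟨e, f, hS e hf, rfl⟩
  · intro A _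
    simp only [Fintype.mem_piFinset, mem_powerset]
    exact fun e => filter_subset _ _
  · intro S hS
    simp only [Fintype.mem_piFinset, mem_powerset] at hS
    funext e
    ext f
    rw [mem_filter]
    constructor
    · rintro ⟨hf, h⟩
      exact (map_embv_mem_glueEdges huv hadj (mem_edgeFin.1 hf)).1 h
    · exact fun hf =>
        ⟨hS e hf, (map_embv_mem_glueEdges huv hadj (mem_edgeFin.1 (hS e hf))).2 hf⟩
  · intro A hA
    rw [mem_powerset, edgeFin_subGraph huv] at hA
    ext x
    rw [mem_glueEdges]
    constructor
    · rintro ⟨e, f, hf, rfl⟩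
      exact (mem_filter.1 hf).2
    · intro hx
      obtain ⟨e, f, hf, rfl⟩ := mem_glueEdges.1 (hA hx)
      exact ⟨e, f, mem_filter.2 ⟨hf, hx⟩, rfl⟩
  · exact fun _ _ => rfl

open Classical in
theorem pow_mul_pow_eq_prod_edgeSet (B : Finset (Sym2 V)) (hB : B ⊆ edgeFin G) (x y : ℝ) :
    x ^ B.card * y ^ ((edgeFin G).card - B.card) = ∏ e : G.edgeSet, if e.1 ∈ B then x else y := by
  rw [← prod_subtype (edgeFin G) (fun e => mem_edgeFin) fun e => if e ∈ B then x else y,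
    prod_ite, prod_const, prod_const, filter_mem_eq_inter, inter_eq_right.2 hB,
    ← card_sdiff_of_subset hB, sdiff_eq_filter]

theorem weight_glueEdges (huv : u ≠ v) (hadj : ¬ H.Adj u v)
    {S : G.edgeSet → Finset (Sym2 W)} (hS : ∀ e, S e ⊆ edgeFin H) (x y : ℝ) :
    x ^ (glueEdges G u v S).card *
        y ^ ((edgeFin (subGraph G H u v)).card - (glueEdges G u v S).card) =
      ∏ e, x ^ (S e).card * y ^ ((edgeFin H).card - (S e).card) := by
  rw [edgeFin_subGraph huv, card_glueEdges huv hadj hS,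
    card_glueEdges huv hadj fun _ => Subset.rfl,
    ← sum_tsub_distrib _ fun e _ => card_le_card (hS e), prod_mul_distrib, prod_pow_eq_pow_sum,
    prod_pow_eq_pow_sum]

open Classical in
theorem relPoly_subGraph (G : SimpleGraph V) [Nonempty V] (H : SimpleGraph W) (huv : u ≠ v)
    (hadj : ¬ H.Adj u v) (q : ℝ) :
    relPoly (subGraph G H u v) q = ∑ B ∈ (edgeFin G).powerset,
      (if (G.deleteEdges (B : Set (Sym2 V))).Connected then
        splitRel H u v q ^ B.card * relPoly H q ^ ((edgeFin G).card - B.card) else 0) := by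
  let T (A : Finset (Sym2 W)) : SimpleGraph W := SimpleGraph.fromEdgeSet (A : Set (Sym2 W))
  let wt (A : Finset (Sym2 W)) : ℝ := (1 - q) ^ A.card * q ^ ((edgeFin H).card - A.card)
  have hfactor (B : Finset (Sym2 V)) (e : G.edgeSet) :
      (if e.1 ∈ B then splitRel H u v q else relPoly H q) =
        ∑ A ∈ (edgeFin H).powerset,
          (if (if e.1 ∈ B then IsSplit (T A) u v else (T A).Connected) then 1 else 0) * wt A := by
    by_cases he : e.1 ∈ B
    · simp only [he, if_true, splitRel, ite_mul, one_mul, zero_mul]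
      exact sum_congr rfl fun A _ => if_congr Iff.rfl rfl rfl
    · simp only [he, if_false, relPoly, ite_mul, one_mul, zero_mul]
      exact sum_congr rfl fun A _ => if_congr Iff.rfl rfl rfl
  have hrhs : ∀ B ∈ (edgeFin G).powerset,
      (if (G.deleteEdges (B : Set (Sym2 V))).Connected then
        splitRel H u v q ^ B.card * relPoly H q ^ ((edgeFin G).card - B.card) else 0) =
      ∑ S ∈ Fintype.piFinset (fun _ : G.edgeSet => (edgeFin H).powerset),
        (if (G.deleteEdges (B : Set (Sym2 V))).Connected then
          ∏ e : G.edgeSet, (if (if e.1 ∈ B then IsSplit (T (S e)) u v else (T (S e)).Connected)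
            then (1 : ℝ) else 0) else 0) * ∏ e, wt (S e) := by
    intro B hB
    rw [pow_mul_pow_eq_prod_edgeSet B (mem_powerset.1 hB)]
    simp only [hfactor, prod_univ_sum, prod_mul_distrib]
    split_ifs <;> simp
  rw [sum_congr rfl hrhs, sum_comm, relPoly, sum_powerset_edgeFin_subGraph huv hadj]
  refine sum_congr rfl fun S hS => ?_
  simp only [Fintype.mem_piFinset, mem_powerset] at hS
  rw [← sum_mul, sum_powerset_ite_connected fun e => T (S e), ite_mul, one_mul, zero_mul,
    weight_glueEdges huv hadj hS]
  exact if_congr (connected_glue_iff G huv _ _ (fromEdgeSet_glueEdges_adj huv)) rfl rfl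

end Gluing

open Classical in
/-- Reliability of an edge-substitution graph: if `G` has `m` edges then
`Rel(G[H]; q) = Rel(H; q)^m · F(G, S(H;q)/Rel(H;q))` whenever `Rel(H;q) ≠ 0`;
equivalently, `Rel(G[H]; q) = ∑_i F_i · S(H;q)^i · Rel(H;q)^{m-i}`. -/
theorem rel_subGraph {V W : Type} [Finite V] [Finite W]
    (G : SimpleGraph V) (hG : G.Connected)
    (H : SimpleGraph W) (hH : H.Connected) (u v : W) (huv : u ≠ v) (hadj : ¬ H.Adj u v)
    (q : ℝ) :
    (relPoly H q ≠ 0 →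
      relPoly (subGraph G H u v) q
        = relPoly H q ^ (edgeFin G).card * Fpoly G (splitRel H u v q / relPoly H q)) ∧
    relPoly (subGraph G H u v) q
      = ∑ B ∈ (edgeFin G).powerset,
          (if (G.deleteEdges (B : Set (Sym2 V))).Connected then
            splitRel H u v q ^ B.card * relPoly H q ^ ((edgeFin G).card - B.card) else 0) := by
  have := hG.nonempty
  have key := relPoly_subGraph G H huv hadj q
  refine ⟨fun hR => ?_, key⟩
  rw [key, Fpoly, mul_sum]
  refine sum_congr rfl fun B hB => ?_
  split_ifs
  · have hle : B.card ≤ (edgeFin G).card := card_le_card (mem_powerset.1 hB)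
    rw [div_pow, ← Nat.sub_add_cancel hle, pow_add, Nat.add_sub_cancel]
    field_simp
  · simp

end
end

section
/- Let K ⊂ (-1,0) be a compact set. Then there is a constant C such that |C_n(q)| ≤ C and |R_n(q)| ≤ C for all integers n ≥ 3 and all q ∈ K; that is, the families of polynomials {C_n} and {R_n} are uniformly bounded on K. -/
open SimpleGraph Finset

noncomputable section

/-- The edges of `G` with both endpoints in `S`. -/
def edgesIn {V : Type} [Fintype V] [DecidableEq V] (G : SimpleGraph V) (S : Finset V) :
    Finset (Sym2 V) :=
  edgeFin G ∩ S.sym2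

/-- The edges of `G[S]` joining `T` to `S \ T` (for `T ⊆ S`). -/
def crossEdges {V : Type} [Fintype V] [DecidableEq V] (G : SimpleGraph V) (S T : Finset V) :
    Finset (Sym2 V) :=
  edgesIn G S \ (edgesIn G T ∪ edgesIn G (S \ T))

open Classical in
/-- The probability that the component of `u` in the random subgraph of `G[S]` is all of `S`,
when every edge fails independently with probability `q`. -/
def rootedRel {V : Type} [Fintype V] [DecidableEq V] (G : SimpleGraph V) (u : V) (S : Finset V)
    (q : ℝ) : ℝ :=
  ∑ A ∈ (edgesIn G S).powerset,
    if ∀ v, (SimpleGraph.fromEdgeSet (A : Set (Sym2 V))).Reachable u v ↔ v ∈ S then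
      (1 - q) ^ A.card * q ^ ((edgesIn G S).card - A.card) else 0

/-- Reachability from `u ∈ T` inside a graph with no edges leaving `T` only uses edges in `T`. -/
lemma reachable_of_no_cross {V : Type} {H H' : SimpleGraph V} {T : Finset V} {u : V} (hu : u ∈ T)
    (hH : ∀ a b, H.Adj a b → a ∈ T → b ∈ T ∧ H'.Adj a b) {v : V} (h : H.Reachable u v) :
    v ∈ T ∧ H'.Reachable u v := by
  obtain ⟨p⟩ := h
  induction p with
  | nil => exact ⟨hu, Reachable.refl _⟩
  | cons hadj _ ih =>
    obtain ⟨hb, hadj'⟩ := hH _ _ hadj hu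
    obtain ⟨h1, h2⟩ := ih hb
    exact ⟨h1, hadj'.reachable.trans h2⟩

section Rooted

variable {V : Type} [Fintype V] [DecidableEq V] (G : SimpleGraph V)

lemma mk_mem_edgesIn {S : Finset V} {a b : V} :
    s(a, b) ∈ edgesIn G S ↔ G.Adj a b ∧ a ∈ S ∧ b ∈ S := by
  simp [edgesIn, edgeFin]

lemma edgesIn_mono {S T : Finset V} (h : T ⊆ S) : edgesIn G T ⊆ edgesIn G S :=
  inter_subset_inter_left (sym2_mono h)

lemma edgesIn_univ : edgesIn G univ = edgeFin G := by simp [edgesIn]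

lemma disjoint_edgesIn (S T : Finset V) : Disjoint (edgesIn G T) (edgesIn G (S \ T)) := by
  rw [Finset.disjoint_left]
  rintro ⟨a, b⟩ h h'
  have h1 := (mk_mem_edgesIn G).1 h
  have h2 := (mk_mem_edgesIn G).1 h'
  simp_all

lemma card_edgesIn_eq {S T : Finset V} (h : T ⊆ S) :
    (edgesIn G S).card =
      (edgesIn G T).card + (edgesIn G (S \ T)).card + (crossEdges G S T).card := by
  rw [← card_union_of_disjoint (disjoint_edgesIn G S T), crossEdges, add_comm,
    card_sdiff_add_card_eq_card]
  exact union_subset (edgesIn_mono G h) (edgesIn_mono G sdiff_subset)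

lemma component_union_iff {S T : Finset V} {u : V} (hu : u ∈ T) {A B : Finset (Sym2 V)}
    (hA : A ⊆ edgesIn G T) (hB : B ⊆ edgesIn G (S \ T)) :
    (∀ v, (SimpleGraph.fromEdgeSet ((A ∪ B : Finset (Sym2 V)) : Set (Sym2 V))).Reachable u v
        ↔ v ∈ T) ↔
      ∀ v, (SimpleGraph.fromEdgeSet (A : Set (Sym2 V))).Reachable u v ↔ v ∈ T := by
  have key : ∀ v, (SimpleGraph.fromEdgeSet ((A ∪ B : Finset (Sym2 V)) : Set (Sym2 V))).Reachable
      u v ↔ (SimpleGraph.fromEdgeSet (A : Set (Sym2 V))).Reachable u v := by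
    refine fun v => ⟨fun h => (reachable_of_no_cross (T := T) hu ?_ h).2, fun h => h.mono ?_⟩
    · intro a b hab ha
      simp only [fromEdgeSet_adj, coe_union, Set.mem_union, mem_coe] at hab ⊢
      rcases hab with ⟨h | h, hne⟩
      · exact ⟨((mk_mem_edgesIn G).1 (hA h)).2.2, h, hne⟩
      · have := ((mk_mem_edgesIn G).1 (hB h)).2.1
        simp_all
    · exact fromEdgeSet_mono (by simp)
  simp only [key]

lemma subset_union_of_component {S T : Finset V} {u : V} {A : Finset (Sym2 V)}
    (hA : A ⊆ edgesIn G S)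
    (h : ∀ v, (SimpleGraph.fromEdgeSet (A : Set (Sym2 V))).Reachable u v ↔ v ∈ T) :
    A ⊆ edgesIn G T ∪ edgesIn G (S \ T) := by
  rintro ⟨a, b⟩ hab
  change s(a, b) ∈ _ at hab
  obtain ⟨hadj, ha, hb⟩ := (mk_mem_edgesIn G).1 (hA hab)
  have hAdj : (SimpleGraph.fromEdgeSet (A : Set (Sym2 V))).Adj a b := by
    simpa [fromEdgeSet_adj] using ⟨hab, hadj.ne⟩
  have hiff : a ∈ T ↔ b ∈ T := by
    rw [← h a, ← h b]
    exact ⟨fun x => x.trans hAdj.reachable, fun x => x.trans hAdj.symm.reachable⟩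
  change s(a, b) ∈ _
  rw [mem_union, mk_mem_edgesIn, mk_mem_edgesIn, mem_sdiff, mem_sdiff]
  tauto

open Classical in
lemma sum_component_eq_s10 {S T : Finset V} (hTS : T ⊆ S) {u : V} (hu : u ∈ T) (q : ℝ) :
    ∑ A ∈ (edgesIn G S).powerset.filter (fun A : Finset (Sym2 V) =>
        ∀ v, (SimpleGraph.fromEdgeSet (A : Set (Sym2 V))).Reachable u v ↔ v ∈ T),
      (1 - q) ^ A.card * q ^ ((edgesIn G S).card - A.card) =
    rootedRel G u T q * q ^ (crossEdges G S T).card := by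
  have hone : ∀ x : ℝ, x = x * ∑ B ∈ (edgesIn G (S \ T)).powerset,
      (1 - q) ^ B.card * q ^ ((edgesIn G (S \ T)).card - B.card) := fun x => by
    rw [sum_pow_mul_eq_add_pow]; simp
  rw [rootedRel, ← sum_filter]
  conv_rhs => rw [hone (Finset.sum _ _), sum_mul_sum, ← sum_product', sum_mul]
  have hdisj := disjoint_edgesIn G S T
  have hcard := card_edgesIn_eq G hTS
  refine sum_nbij' (fun A => (A ∩ edgesIn G T, A ∩ edgesIn G (S \ T))) (fun P => P.1 ∪ P.2)
    ?_ ?_ ?_ ?_ ?_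
  · intro A hA
    simp only [mem_filter, mem_powerset, mem_product] at hA ⊢
    refine ⟨⟨inter_subset_right, ?_⟩, inter_subset_right⟩
    rw [← component_union_iff G hu inter_subset_right
      (inter_subset_right : A ∩ edgesIn G (S \ T) ⊆ _), ← inter_union_distrib_left,
      inter_eq_left.2 (subset_union_of_component G hA.1 hA.2)]
    exact hA.2
  · rintro ⟨A, B⟩ h
    simp only [mem_filter, mem_powerset, mem_product] at h ⊢
    exact ⟨union_subset (h.1.1.trans (edgesIn_mono G hTS))
      (h.2.trans (edgesIn_mono G sdiff_subset)), (component_union_iff G hu h.1.1 h.2).2 h.1.2⟩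
  · intro A hA
    simp only [mem_filter, mem_powerset] at hA
    simp only [← inter_union_distrib_left]
    exact inter_eq_left.2 (subset_union_of_component G hA.1 hA.2)
  · rintro ⟨A, B⟩ h
    simp only [mem_filter, mem_powerset, mem_product] at h
    have h1 : B ∩ edgesIn G T = ∅ :=
      disjoint_iff_inter_eq_empty.1 (hdisj.symm.mono_left h.2)
    have h2 : A ∩ edgesIn G (S \ T) = ∅ :=
      disjoint_iff_inter_eq_empty.1 (hdisj.mono_left h.1.1)
    simp [union_inter_distrib_right, h1, h2, inter_eq_left.2 h.1.1, inter_eq_left.2 h.2]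
  · intro A hA
    simp only [mem_filter, mem_powerset] at hA
    have hsplit := subset_union_of_component G hA.1 hA.2
    have hA' : A.card = (A ∩ edgesIn G T).card + (A ∩ edgesIn G (S \ T)).card := by
      rw [← card_union_of_disjoint
        (hdisj.mono inter_subset_right inter_subset_right), ← inter_union_distrib_left,
        inter_eq_left.2 hsplit]
    have h1 : (A ∩ edgesIn G T).card ≤ (edgesIn G T).card := card_le_card inter_subset_right
    have h2 : (A ∩ edgesIn G (S \ T)).card ≤ (edgesIn G (S \ T)).card :=
      card_le_card inter_subset_right
    have he : (edgesIn G S).card - A.card =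
        ((edgesIn G T).card - (A ∩ edgesIn G T).card) +
        ((edgesIn G (S \ T)).card - (A ∩ edgesIn G (S \ T)).card) +
        (crossEdges G S T).card := by omega
    rw [he, hA']
    ring

/-- Conditioning on the component of `u`. -/
lemma sum_rootedRel_eq_one {S : Finset V} {u : V} (hu : u ∈ S) (q : ℝ) :
    ∑ T ∈ (S.erase u).powerset,
      rootedRel G u (insert u T) q * q ^ (crossEdges G S (insert u T)).card = 1 := by
  classical
  have htotal : ∑ A ∈ (edgesIn G S).powerset,
      (1 - q) ^ A.card * q ^ ((edgesIn G S).card - A.card) = 1 := by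
    rw [sum_pow_mul_eq_add_pow]; simp
  let comp : Finset (Sym2 V) → Finset V := fun A =>
    univ.filter fun v => (SimpleGraph.fromEdgeSet (A : Set (Sym2 V))).Reachable u v
  refine Eq.trans ?_ htotal
  rw [← sum_fiberwise_of_maps_to (s := (edgesIn G S).powerset)
    (t := (S.erase u).powerset) (g := fun A => (comp A).erase u)]
  · refine sum_congr rfl fun T hT => ?_
    rw [mem_powerset] at hT
    have huT : u ∉ T := fun h => by simpa using hT h
    rw [← sum_component_eq_s10 G (insert_subset hu (hT.trans (erase_subset _ _)))
      (mem_insert_self u T)]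
    refine sum_congr ?_ fun _ _ => rfl
    refine filter_congr fun A _ => ?_
    have hmem : u ∈ comp A := by simp [comp]
    constructor
    · intro h
      have : comp A = insert u T := by ext v; simpa [comp] using h v
      rw [this, erase_insert huT]
    · intro h v
      rw [← h, insert_erase hmem]
      simp [comp]
  · intro A hA
    rw [mem_powerset] at hA ⊢
    refine erase_subset_erase _ fun v hv => ?_
    simp only [comp, mem_filter, mem_univ, true_and] at hv
    refine (reachable_of_no_cross (H' := ⊤) hu (fun a b hab _ => ?_) hv).1
    rw [fromEdgeSet_adj] at hab
    exact ⟨((mk_mem_edgesIn G).1 (hA hab.1)).2.2, hab.2⟩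

lemma abs_rootedRel_le {q : ℝ} (hq : |q| ≤ 1) (u : V) (S : Finset V) :
    |rootedRel G u S q| ≤ 3 ^ (S.card + 1).choose 2 := by
  classical
  calc |rootedRel G u S q|
      ≤ ∑ A ∈ (edgesIn G S).powerset, |1 - q| ^ A.card * |q| ^ ((edgesIn G S).card - A.card) := by
        refine (abs_sum_le_sum_abs _ _).trans (sum_le_sum fun A _ => ?_)
        split_ifs
        · rw [abs_mul, abs_pow, abs_pow]
        · rw [abs_zero]; positivity
    _ = (|1 - q| + |q|) ^ (edgesIn G S).card := sum_pow_mul_eq_add_pow _ _ _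
    _ ≤ 3 ^ (edgesIn G S).card := by
        gcongr
        have := abs_sub (1 : ℝ) q
        rw [abs_one] at this
        linarith
    _ ≤ 3 ^ (S.card + 1).choose 2 := by
        refine pow_le_pow_right₀ (by norm_num) ?_
        rw [← card_sym2]
        exact card_le_card inter_subset_right

lemma card_crossEdges_ge {e : Sym2 V} (hG : ∀ a b, a ≠ b → s(a, b) ≠ e → G.Adj a b)
    {S T : Finset V} (hTS : T ⊆ S) :
    T.card * (S \ T).card - 1 ≤ (crossEdges G S T).card := by
  have hinj : Set.InjOn (fun p : V × V => s(p.1, p.2)) (T ×ˢ (S \ T) : Finset (V × V)) := by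
    rintro ⟨a, b⟩ h ⟨c, d⟩ h' heq
    simp only [coe_product, Set.mem_prod, mem_coe, mem_sdiff] at h h'
    simp only [Sym2.eq_iff] at heq
    rcases heq with ⟨rfl, rfl⟩ | ⟨rfl, rfl⟩
    · rfl
    · exact absurd h.1 h'.2.2
  rw [← card_product, ← card_image_of_injOn hinj]
  refine pred_card_le_card_erase.trans (card_le_card (s := erase _ e) ?_)
  intro f hf
  rw [mem_erase, mem_image] at hf
  obtain ⟨hne, ⟨a, b⟩, hab, rfl⟩ := hf
  rw [mem_product, mem_sdiff] at hab
  obtain ⟨ha, hb, hb'⟩ := hab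
  have hadj := hG a b (fun h => hb' (h ▸ ha)) hne
  simp only [crossEdges, mem_sdiff, mem_union, mk_mem_edgesIn]
  exact ⟨⟨hadj, hTS ha, hb⟩, by tauto⟩

end Rooted

lemma mul_sub_one_ge_mul_half {N j i : ℕ} (hi : 1 ≤ i) (hN : j + i = N) :
    (N - 1) / 2 * i ≤ (j + 1) * i - 1 ∨ (N - 1) / 2 * (j + 1) ≤ (j + 1) * i - 1 := by
  rcases le_total i (j + 1) with h | h
  · left
    have : ((N - 1) / 2 + 1) * i ≤ (j + 1) * i := Nat.mul_le_mul_right _ (by omega)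
    rw [add_mul] at this
    omega
  · right
    have : (j + 1) * ((N - 1) / 2 + 1) ≤ (j + 1) * i := Nat.mul_le_mul_left _ (by omega)
    rw [mul_add, mul_comm (j + 1) ((N - 1) / 2)] at this
    omega

lemma sum_choose_mul_pow_le {r : ℝ} (h0 : 0 ≤ r) (h1 : r ≤ 1) (N : ℕ) :
    ∑ j ∈ range N, (N.choose j : ℝ) * r ^ ((j + 1) * (N - j) - 1) ≤
      (1 + r ^ ((N - 1) / 2)) ^ N - 1 + r ^ ((N - 1) / 2) * (1 + r ^ ((N - 1) / 2)) ^ N := by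
  set x := r ^ ((N - 1) / 2) with hx
  have hx0 : 0 ≤ x := pow_nonneg h0 _
  have hterm : ∀ j ∈ range N, (N.choose j : ℝ) * r ^ ((j + 1) * (N - j) - 1) ≤
      N.choose j * x ^ (N - j) + x * (N.choose j * x ^ j) := by
    intro j hj
    rw [mem_range] at hj
    have hle : r ^ ((j + 1) * (N - j) - 1) ≤ x ^ (N - j) + x ^ (j + 1) := by
      rcases mul_sub_one_ge_mul_half (N := N) (j := j) (i := N - j) (by omega) (by omega)
        with h | h
      · refine le_add_of_le_of_nonneg ?_ (by positivity)
        rw [hx, ← pow_mul]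
        exact pow_le_pow_of_le_one h0 h1 h
      · refine le_add_of_nonneg_of_le (by positivity) ?_
        rw [hx, ← pow_mul]
        exact pow_le_pow_of_le_one h0 h1 h
    calc (N.choose j : ℝ) * r ^ ((j + 1) * (N - j) - 1)
        ≤ N.choose j * (x ^ (N - j) + x ^ (j + 1)) := by gcongr
      _ = _ := by ring
  refine (sum_le_sum hterm).trans ?_
  rw [sum_add_distrib, ← mul_sum]
  have e1 : (1 + x) ^ N = ∑ j ∈ range N, (N.choose j : ℝ) * x ^ (N - j) + 1 := by
    rw [add_pow, sum_range_succ]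
    simp [mul_comm]
  have e2 : (1 + x) ^ N = ∑ j ∈ range N, (N.choose j : ℝ) * x ^ j + x ^ N := by
    rw [add_comm, add_pow, sum_range_succ]
    simp [mul_comm]
  have e3 : ∑ j ∈ range N, (N.choose j : ℝ) * x ^ j ≤ (1 + x) ^ N := by
    rw [e2]; exact le_add_of_nonneg_right (by positivity)
  have := mul_le_mul_of_nonneg_left e3 hx0
  linarith

open Filter Topology in
lemma tendsto_sum_choose_mul_pow {r : ℝ} (h0 : 0 ≤ r) (h1 : r < 1) :
    Tendsto (fun N : ℕ => ∑ j ∈ range N, (N.choose j : ℝ) * r ^ ((j + 1) * (N - j) - 1))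
      atTop (𝓝 0) := by
  have hpow : Tendsto (fun h : ℕ => r ^ h) atTop (𝓝 0) :=
    tendsto_pow_atTop_nhds_zero_of_lt_one h0 h1
  have hlin : Tendsto (fun h : ℕ => (2 * h + 2 : ℝ) * r ^ h) atTop (𝓝 0) := by
    have := ((tendsto_self_mul_const_pow_of_lt_one h0 h1).const_mul 2).add (hpow.const_mul 2)
    simp only [mul_zero, add_zero] at this
    exact this.congr fun h => by ring
  have hexp : Tendsto (fun h : ℕ => Real.exp ((2 * h + 2 : ℝ) * r ^ h)) atTop (𝓝 1) := by
    exact (Real.continuous_exp.tendsto' 0 1 Real.exp_zero).comp hlin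
  have hbound := (hexp.sub_const 1).add (hpow.mul hexp)
  simp only [sub_self, zero_mul, add_zero] at hbound
  have hdiv : Tendsto (fun N : ℕ => (N - 1) / 2) atTop atTop :=
    tendsto_atTop.2 fun b => eventually_atTop.2 ⟨2 * b + 1, fun N hN => by omega⟩
  refine squeeze_zero (fun N => sum_nonneg fun _ _ => by positivity) (fun N => ?_)
    (hbound.comp hdiv)
  refine (sum_choose_mul_pow_le h0 h1.le N).trans ?_
  set h := (N - 1) / 2 with hh
  have hx0 : 0 ≤ r ^ h := pow_nonneg h0 _
  have hNh : (N : ℝ) ≤ 2 * h + 2 := by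
    have : N ≤ 2 * h + 2 := by omega
    exact_mod_cast this
  have hle : (1 + r ^ h) ^ N ≤ Real.exp ((2 * h + 2 : ℝ) * r ^ h) := by
    calc (1 + r ^ h) ^ N ≤ Real.exp (r ^ h) ^ N := by
          gcongr
          rw [add_comm]
          exact Real.add_one_le_exp _
      _ = Real.exp (N * r ^ h) := (Real.exp_nat_mul _ _).symm
      _ ≤ _ := by gcongr
  simp only [Function.comp_apply, ← hh]
  gcongr

lemma abs_rootedRel_recursion {V : Type} [Fintype V] [DecidableEq V] (G : SimpleGraph V)
    {e : Sym2 V} (hG : ∀ a b, a ≠ b → s(a, b) ≠ e → G.Adj a b) {q r M : ℝ}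
    (hqr : |q| ≤ r) (hr : r ≤ 1) (hM : 0 ≤ M) {u : V} {S : Finset V} (hu : u ∈ S)
    (ih : ∀ T, T ⊂ S → u ∈ T → |rootedRel G u T q| ≤ M) :
    |rootedRel G u S q| ≤ 1 + M * ∑ j ∈ range (S.card - 1),
      ((S.card - 1).choose j : ℝ) * r ^ ((j + 1) * (S.card - 1 - j) - 1) := by
  have hr0 : 0 ≤ r := (abs_nonneg q).trans hqr
  have hcard : (S.erase u).card = S.card - 1 := card_erase_of_mem hu
  set N := S.card - 1 with hN
  have hSpos : 0 < S.card := card_pos.2 ⟨u, hu⟩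
  have hrec := sum_rootedRel_eq_one G hu q
  rw [← add_sum_erase _ _ (mem_powerset_self (S.erase u)), insert_erase hu] at hrec
  have hself : (crossEdges G S S).card = 0 := by
    rw [card_eq_zero, crossEdges]
    exact sdiff_eq_empty_iff_subset.2 subset_union_left
  rw [hself, pow_zero, mul_one] at hrec
  rw [eq_sub_of_add_eq hrec]
  refine (abs_sub _ _).trans ?_
  rw [abs_one]
  gcongr
  calc |∑ T ∈ (S.erase u).powerset.erase (S.erase u),
        rootedRel G u (insert u T) q * q ^ (crossEdges G S (insert u T)).card|
      ≤ ∑ T ∈ (S.erase u).powerset.erase (S.erase u),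
        M * r ^ ((T.card + 1) * (N - T.card) - 1) := by
        refine (abs_sum_le_sum_abs _ _).trans (sum_le_sum fun T hT => ?_)
        rw [mem_erase, mem_powerset] at hT
        obtain ⟨hne, hsub⟩ := hT
        have huT : u ∉ T := fun h => by simpa using hsub h
        have hins : insert u T ⊆ S := insert_subset hu (hsub.trans (erase_subset _ _))
        have hss : insert u T ⊂ S := by
          refine hins.ssubset_of_ne fun h => hne ?_
          rw [← h, erase_insert huT]
        have hcross := card_crossEdges_ge G hG hins
        rw [card_sdiff_of_subset hins, card_insert_of_notMem huT] at hcross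
        have hexp : S.card - (T.card + 1) = N - T.card := by omega
        rw [hexp] at hcross
        rw [abs_mul, abs_pow]
        refine mul_le_mul (ih _ hss (mem_insert_self _ _)) ?_ (by positivity) hM
        exact (pow_le_pow_left₀ (abs_nonneg q) hqr _).trans
          (pow_le_pow_of_le_one hr0 hr hcross)
    _ = M * ∑ j ∈ range N, (N.choose j : ℝ) * r ^ ((j + 1) * (N - j) - 1) := by
        rw [← mul_sum]
        congr 1
        have h1 := add_sum_erase _ (fun T => r ^ ((T.card + 1) * (N - T.card) - 1))
          (mem_powerset_self (S.erase u))
        rw [sum_powerset_apply_card (fun k => r ^ ((k + 1) * (N - k) - 1)), hcard,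
          sum_range_succ, add_comm] at h1
        simpa using h1

/-- Complete graphs with at most one missing edge have uniformly bounded reliability. -/
lemma exists_bound_rootedRel {r : ℝ} (h0 : 0 ≤ r) (h1 : r < 1) :
    ∃ M : ℝ, ∀ (V : Type) [Fintype V] [DecidableEq V] (G : SimpleGraph V) (e : Sym2 V),
      (∀ a b, a ≠ b → s(a, b) ≠ e → G.Adj a b) → ∀ q : ℝ, |q| ≤ r → ∀ (u : V) (S : Finset V),
        u ∈ S → |rootedRel G u S q| ≤ M := by
  obtain ⟨N₀, hN₀⟩ := Filter.eventually_atTop.1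
    ((tendsto_sum_choose_mul_pow h0 h1).eventually_le_const (by norm_num : (0 : ℝ) < 1 / 2))
  refine ⟨max 2 (3 ^ (N₀ + 1).choose 2), fun V _ _ G e hG q hq u S => ?_⟩
  set M : ℝ := max 2 (3 ^ (N₀ + 1).choose 2)
  have hM : 2 ≤ M := le_max_left _ _
  induction S using Finset.strongInduction with
  | H S ih =>
    intro hu
    rcases le_or_gt S.card N₀ with h | h
    · refine (abs_rootedRel_le G (hq.trans h1.le) u S).trans (le_trans ?_ (le_max_right _ _))
      exact pow_le_pow_right₀ (by norm_num) (Nat.choose_le_choose _ (by omega))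
    · refine (abs_rootedRel_recursion G hG hq h1.le (by linarith) hu ih).trans ?_
      have := mul_le_mul_of_nonneg_left (hN₀ (S.card - 1) (by omega)) (by linarith : 0 ≤ M)
      linarith

lemma relPoly_eq_rootedRel {V : Type} [Fintype V] [DecidableEq V] (G : SimpleGraph V) (u : V)
    (q : ℝ) : relPoly G q = rootedRel G u univ q := by
  rw [relPoly, rootedRel, edgesIn_univ]
  refine sum_congr rfl fun A _ => ?_
  have hiff : (SimpleGraph.fromEdgeSet (A : Set (Sym2 V))).Connected ↔
      ∀ v, (SimpleGraph.fromEdgeSet (A : Set (Sym2 V))).Reachable u v ↔ v ∈ univ := by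
    simp only [mem_univ, iff_true]
    exact ⟨fun h v => h.preconnected u v, fun h =>
      { preconnected := fun a b => (h a).symm.trans (h b), nonempty := ⟨u⟩ }⟩
  by_cases h : (SimpleGraph.fromEdgeSet (A : Set (Sym2 V))).Connected
  · rw [if_pos h, if_pos (hiff.1 h)]
  · rw [if_neg h, if_neg (mt hiff.2 h)]

/-- The families `{C_n}` and `{R_n}` are uniformly bounded on any compact `K ⊂ (-1, 0)`. -/
theorem uniformly_bounded (K : Set ℝ) (hKc : IsCompact K) (hK : K ⊆ Set.Ioo (-1 : ℝ) 0) :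
    ∃ C : ℝ, ∀ n : ℕ, 3 ≤ n → ∀ q ∈ K, |Cfun n q| ≤ C ∧ |Rfun n q| ≤ C := by
  rcases K.eq_empty_or_nonempty with rfl | hne
  · exact ⟨0, by simp⟩
  obtain ⟨x, hx, hmax⟩ := hKc.exists_isMaxOn hne continuous_abs.continuousOn
  have hx1 : |x| < 1 := abs_lt.2 ⟨(hK hx).1, (hK hx).2.trans one_pos⟩
  obtain ⟨M, hM⟩ := exists_bound_rootedRel (abs_nonneg x) hx1
  refine ⟨M, fun n hn q hq => ?_⟩
  let u : Fin n := ⟨0, by omega⟩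
  let v : Fin n := ⟨1, by omega⟩
  rw [Cfun, Rfun, relPoly_eq_rootedRel _ u, relPoly_eq_rootedRel _ u]
  refine ⟨hM _ _ s(u, v) ?_ q (hmax hq) u _ (mem_univ _),
    hM _ _ s(u, v) ?_ q (hmax hq) u _ (mem_univ _)⟩
  · exact fun a b hab _ => hab
  · intro a b hab he
    rw [Hgraph, deleteEdges_adj]
    exact ⟨hab, fun ⟨_, h⟩ => he h⟩

end
end
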